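/- Let A be a representation-finite algebra whose Auslander-Reiten quiver Γ_A is a directed component (no oriented cycles). Let P be an indecomposable projective A-module and M an indecomposable module such that either M is a direct summand of rad P, or there is an irreducible morphism from a direct summand of rad P to M with M ≇ P. Then M is not a successor of P in ind A. -/

import Mathlib

open CategoryTheory
open scoped Classical

/-! ## Quiver combinatorics -/

/-- Paths in a quiver given by source and target maps. -/
inductive QPath {V E : Type} (src tgt : E → V) : V → V → Type
  | nil (a : V) : QPath src tgt a a
  | cons {a b : V} (p : QPath src tgt a b) (α : E) (h : src α = b) : QPath src tgt a (tgt α)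

namespace QPath

variable {V E : Type} {src tgt : E → V}

def length : ∀ {a b : V}, QPath src tgt a b → ℕ
  | _, _, .nil _ => 0
  | _, _, .cons p _ _ => p.length + 1

def comp : ∀ {a b c : V}, QPath src tgt a b → QPath src tgt b c → QPath src tgt a c
  | _, _, _, p, .nil _ => p
  | _, _, _, p, .cons q α h => .cons (p.comp q) α h

/-- The list of vertices visited by a path, in order. -/
def verts : ∀ {a b : V}, QPath src tgt a b → List V
  | a, _, .nil _ => [a]
  | _, _, .cons p α _ => p.verts ++ [tgt α]

/-- The interior (intermediate) vertices of a path. -/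
def interior {a b : V} (p : QPath src tgt a b) : List V :=
  (p.verts.dropLast).drop 1

/-- The list of arrows of a path, in walk order. -/
def arrows : ∀ {a b : V}, QPath src tgt a b → List E
  | _, _, .nil _ => []
  | _, _, .cons p α _ => p.arrows ++ [α]

end QPath

/-- A presentation of the algebra `A` by the (ordinary) quiver with vertex set `V`
and arrow set `E` : a complete family of orthogonal primitive idempotents indexed by
the vertices together with generators indexed by the arrows. -/
structure QuiverPresentation (k A V E : Type) [Field k] [Ring A] [Algebra k A]
    [Fintype V] [Fintype E] where
  src : E → V
  tgt : E → V
  idem : V → A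
  arrow : E → A
  idem_idem : ∀ a : V, idem a * idem a = idem a
  idem_orth : ∀ a b : V, a ≠ b → idem a * idem b = 0
  sum_idem : ∑ a : V, idem a = 1
  idem_ne : ∀ a : V, idem a ≠ 0
  idem_primitive : ∀ (v : V) (f g : A), f * f = f → g * g = g → f * g = 0 → g * f = 0 →
    f + g = idem v → f = 0 ∨ g = 0
  arrow_mem : ∀ α : E, idem (tgt α) * arrow α * idem (src α) = arrow α
  arrow_ne : ∀ α : E, arrow α ≠ 0
  generates : Algebra.adjoin k (Set.range idem ∪ Set.range arrow) = ⊤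

namespace QuiverPresentation

variable {k A V E : Type} [Field k] [Ring A] [Algebra k A] [Fintype V] [Fintype E]

/-- The product in `A` of the arrows along a path (paths are written right to left). -/
def qprod (P : QuiverPresentation k A V E) :
    ∀ {a b : V}, QPath P.src P.tgt a b → A
  | _, _, .nil a => P.idem a
  | _, _, .cons p α _ => P.arrow α * P.qprod p

/-- The ideal of relations is admissible: all sufficiently long paths vanish. -/
def Admissible (P : QuiverPresentation k A V E) : Prop :=
  ∃ N : ℕ, ∀ (a b : V) (p : QPath P.src P.tgt a b), N ≤ p.length → P.qprod p = 0

/-- The presentation is minimal: the idempotents and the arrows are linearly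
independent modulo the span of the products of paths of length at least two,
so that `(V, E)` really is the ordinary quiver of `A`. -/
def Minimal (P : QuiverPresentation k A V E) : Prop :=
  ∀ (c : V → k) (d : E → k),
    ((∑ a : V, c a • P.idem a) + ∑ α : E, d α • P.arrow α) ∈
      Submodule.span k {x : A | ∃ (a b : V) (p : QPath P.src P.tgt a b),
        2 ≤ p.length ∧ P.qprod p = x} →
    (∀ a, c a = 0) ∧ (∀ α, d α = 0)

/-- The algebra is monomial: the ideal of relations is generated by paths; equivalently,
the images of the paths which do not vanish are linearly independent. -/
def Monomial (P : QuiverPresentation k A V E) : Prop :=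
  LinearIndependent k
    (fun q : {q : Σ a : V, Σ b : V, QPath P.src P.tgt a b // P.qprod q.2.2 ≠ 0} =>
      P.qprod q.1.2.2)

/-- A (minimal) zero-relation: a path of length at least two whose product vanishes
while the product along every proper subpath does not. -/
def IsZeroRel (P : QuiverPresentation k A V E) {a b : V} (p : QPath P.src P.tgt a b) : Prop :=
  P.qprod p = 0 ∧ 2 ≤ p.length ∧
  ∀ (x y : V) (q : QPath P.src P.tgt x y) (p₁ : QPath P.src P.tgt a x)
    (p₂ : QPath P.src P.tgt y b),
      p = p₁.comp (q.comp p₂) → q.length < p.length → P.qprod q ≠ 0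

/-- A vertex `u` is involved in a zero-relation `α_m ⋯ α_1` if `u = s(α_i)`
for some `i = 2, …, m`, i.e. `u` is an interior vertex of the relation. -/
def InvolvedInZeroRel (P : QuiverPresentation k A V E) (u : V) : Prop :=
  ∃ (a b : V) (p : QPath P.src P.tgt a b), P.IsZeroRel p ∧ u ∈ p.interior

/-! ### Walks (for strings and for connectivity) -/

/-- The starting vertex of a step (an arrow traversed forwards or backwards). -/
def stepSrc (P : QuiverPresentation k A V E) (s : E × Bool) : V :=
  if s.2 then P.src s.1 else P.tgt s.1

/-- The ending vertex of a step. -/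
def stepTgt (P : QuiverPresentation k A V E) (s : E × Bool) : V :=
  if s.2 then P.tgt s.1 else P.src s.1

/-- `l` is a walk from `a` to `b` in the underlying graph of the quiver. -/
def IsWalkFrom (P : QuiverPresentation k A V E) : V → List (E × Bool) → V → Prop
  | a, [], b => a = b
  | a, s :: l, b => P.stepSrc s = a ∧ P.IsWalkFrom (P.stepTgt s) l b

/-- The product in `A` of a list of arrows (listed in walk order). -/
def wprod (P : QuiverPresentation k A V E) (l : List E) : A :=
  ((l.map P.arrow).reverse).prod

/-- A reduced walk: no step is immediately followed by its inverse. -/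
def Reduced (l : List (E × Bool)) : Prop :=
  ¬ ∃ (l₁ : List (E × Bool)) (s : E × Bool) (l₂ : List (E × Bool)),
      l = l₁ ++ s :: (s.1, !s.2) :: l₂

/-- No direct subwalk of `l` nor the inverse of such lies in the ideal of relations. -/
def NoZeroSub (P : QuiverPresentation k A V E) (l : List (E × Bool)) : Prop :=
  ∀ (l₁ : List (E × Bool)) (r : List E) (l₂ : List (E × Bool)),
    (l = l₁ ++ (r.map (fun e => (e, true))) ++ l₂ → P.wprod r ≠ 0) ∧
    (l = l₁ ++ (r.map (fun e => (e, false))) ++ l₂ → P.wprod r.reverse ≠ 0)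

/-- A string from `a` to `b`. -/
def IsStringWalk (P : QuiverPresentation k A V E) (a : V) (l : List (E × Bool)) (b : V) : Prop :=
  P.IsWalkFrom a l b ∧ Reduced l ∧ P.NoZeroSub l

/-- `(Q_u^s)_0` : the strings starting at `u` that are trivial or start with an arrow. -/
def QSset (P : QuiverPresentation k A V E) (u : V) : Set (List (E × Bool)) :=
  {l | ∃ b : V, P.IsStringWalk u l b ∧ (l = [] ∨ ∃ (α : E) (l' : List (E × Bool)),
    l = (α, true) :: l')}

/-- `(Q_u^e)_0` : the strings ending at `u` that are trivial or end with an arrow. -/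
def QEset (P : QuiverPresentation k A V E) (u : V) : Set (List (E × Bool)) :=
  {l | ∃ a : V, P.IsStringWalk a l u ∧ (l = [] ∨ ∃ (α : E) (l' : List (E × Bool)),
    l = l' ++ [(α, true)])}

/-- `S_γ` : the strings starting with the arrow `γ`. -/
def Sarr (P : QuiverPresentation k A V E) (γ : E) : Set (List (E × Bool)) :=
  {l | ∃ b : V, P.IsStringWalk (P.src γ) l b ∧ ∃ l' : List (E × Bool), l = (γ, true) :: l'}

/-- `E_γ` : the strings ending with the arrow `γ`. -/
def Earr (P : QuiverPresentation k A V E) (γ : E) : Set (List (E × Bool)) :=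
  {l | ∃ a : V, P.IsStringWalk a l (P.tgt γ) ∧ ∃ l' : List (E × Bool), l = l' ++ [(γ, true)]}

/-- The defining conditions of a string algebra. -/
def IsStringAlgebra (P : QuiverPresentation k A V E) : Prop :=
  P.Monomial ∧
  (∀ v : V, Nat.card {α : E // P.src α = v} ≤ 2) ∧
  (∀ v : V, Nat.card {α : E // P.tgt α = v} ≤ 2) ∧
  (∀ γ : E, Nat.card {β : E // P.src β = P.tgt γ ∧ P.arrow β * P.arrow γ ≠ 0} ≤ 1) ∧
  (∀ β : E, Nat.card {γ : E // P.src β = P.tgt γ ∧ P.arrow β * P.arrow γ ≠ 0} ≤ 1)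

/-- Connectivity in the underlying graph, avoiding a given set of arrows. -/
def ConnAvoid (P : QuiverPresentation k A V E) (avoid : Set E) (a b : V) : Prop :=
  ∃ l : List (E × Bool), P.IsWalkFrom a l b ∧ ∀ s ∈ l, s.1 ∉ avoid

def Connected (P : QuiverPresentation k A V E) : Prop := ∀ a b : V, P.ConnAvoid ∅ a b

/-- The underlying graph of the quiver is a tree. -/
def IsTreeQuiver (P : QuiverPresentation k A V E) : Prop :=
  P.Connected ∧ Fintype.card E + 1 = Fintype.card V

/-- The underlying (undirected) graph of the quiver is given by the edge-endpoint
specification `ends` on `nV` vertices and `nE` edges. -/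
def GraphSpec (P : QuiverPresentation k A V E) (nV nE : ℕ) (ends : Fin nE → ℕ × ℕ) : Prop :=
  ∃ (v : Fin nV ≃ V) (ar : Fin nE ≃ E), ∀ i : Fin nE, ∃ a b : Fin nV,
    (a : ℕ) = (ends i).1 ∧ (b : ℕ) = (ends i).2 ∧
    ((P.src (ar i) = v a ∧ P.tgt (ar i) = v b) ∨ (P.src (ar i) = v b ∧ P.tgt (ar i) = v a))

/-- The directed quiver is given by the arrow specification `ends`. -/
def DirGraphSpec (P : QuiverPresentation k A V E) (nV nE : ℕ) (ends : Fin nE → ℕ × ℕ) : Prop :=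
  ∃ (v : Fin nV ≃ V) (ar : Fin nE ≃ E), ∀ i : Fin nE, ∃ a b : Fin nV,
    (a : ℕ) = (ends i).1 ∧ (b : ℕ) = (ends i).2 ∧
    P.src (ar i) = v a ∧ P.tgt (ar i) = v b

/-- The underlying graph of the full subquiver on vertices `S` and arrows `T`. -/
def SubGraphSpec (P : QuiverPresentation k A V E) (S : Set V) (T : Set E)
    (nV nE : ℕ) (ends : Fin nE → ℕ × ℕ) : Prop :=
  ∃ (v : Fin nV ≃ S) (ar : Fin nE ≃ T), ∀ i : Fin nE, ∃ a b : Fin nV,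
    (a : ℕ) = (ends i).1 ∧ (b : ℕ) = (ends i).2 ∧
    ((P.src (ar i) = v a ∧ P.tgt (ar i) = v b) ∨ (P.src (ar i) = v b ∧ P.tgt (ar i) = v a))

end QuiverPresentation

/-- Edge endpoints of the Dynkin graph `A_n`. -/
def typeAEnds (n : ℕ) : Fin (n - 1) → ℕ × ℕ := fun i => ((i : ℕ), (i : ℕ) + 1)

/-- Edge endpoints of the Dynkin graph `D_n`. -/
def typeDEnds (n : ℕ) : Fin (n - 1) → ℕ × ℕ := fun i =>
  if (i : ℕ) = 0 then (0, 2) else if (i : ℕ) = 1 then (1, 2) else ((i : ℕ), (i : ℕ) + 1)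

/-- Edge endpoints of the Dynkin graph `E_m` for `m = 6, 7, 8`. -/
def typeEEnds (m : ℕ) : Fin (m - 1) → ℕ × ℕ := fun i =>
  if (i : ℕ) = m - 2 then (2, m - 1) else ((i : ℕ), (i : ℕ) + 1)

/-! ## The module category, its radical and the nilpotency index -/

section ModuleSide

variable (A : Type) [Ring A]

/-- An indecomposable module: non-zero, with no non-trivial idempotent endomorphism. -/
def Indec (M : ModuleCat.{0} A) : Prop :=
  Nontrivial M ∧ ∀ f : M ⟶ M, f ≫ f = f → f = 0 ∨ f = 𝟙 M

/-- A finitely generated indecomposable module. -/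
def FinIndec (M : ModuleCat.{0} A) : Prop := Module.Finite A M ∧ Indec A M

/-- `A` is representation-finite: finitely many finitely generated indecomposables
up to isomorphism. -/
def RepFinite : Prop :=
  ∃ (n : ℕ) (T : Fin n → ModuleCat.{0} A),
    ∀ M : ModuleCat.{0} A, FinIndec A M → ∃ i, Nonempty (M ≅ T i)

/-- `A` is (left) hereditary. -/
def Hereditary : Prop := ∀ I : Submodule A A, Module.Projective A I

/-- An irreducible morphism: it does not split, and in any factorization one of
the factors splits. -/
def IrredMor {X Y : ModuleCat.{0} A} (f : X ⟶ Y) : Prop :=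
  (¬ ∃ g : Y ⟶ X, f ≫ g = 𝟙 X) ∧ (¬ ∃ g : Y ⟶ X, g ≫ f = 𝟙 Y) ∧
  ∀ (Z : ModuleCat.{0} A), Module.Finite A Z → ∀ (u : X ⟶ Z) (v : Z ⟶ Y), f = u ≫ v →
    (∃ r : Z ⟶ X, u ≫ r = 𝟙 X) ∨ (∃ s : Y ⟶ Z, s ≫ v = 𝟙 Y)

/-- The radical of `Hom(X, Y)`. -/
def radSet (X Y : ModuleCat.{0} A) : Set (X ⟶ Y) :=
  {f | ∀ M : ModuleCat.{0} A, FinIndec A M →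
    ∀ (h : M ⟶ X) (h' : Y ⟶ M), ¬ IsIso (h ≫ f ≫ h')}

/-- Compositions of `n` radical morphisms. -/
def radPowSet : ℕ → ∀ (X Y : ModuleCat.{0} A), Set (X ⟶ Y)
  | 0, _, _ => Set.univ
  | n + 1, X, Y => {f | ∃ (M : ModuleCat.{0} A) (g : X ⟶ M) (h : M ⟶ Y),
      Module.Finite A M ∧ g ∈ radSet A X M ∧ h ∈ radPowSet n M Y ∧ f = g ≫ h}

/-- The `n`-th power of the radical of `mod A` vanishes. -/
def RadVanishes (n : ℕ) : Prop :=
  ∀ X Y : ModuleCat.{0} A, Module.Finite A X → Module.Finite A Y →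
    ∀ f ∈ radPowSet A n X Y, f = 0

/-- `m` is the nilpotency index of the radical of `mod A`. -/
def NilpotencyIndex (m : ℕ) : Prop :=
  1 ≤ m ∧ RadVanishes A m ∧ ∀ l : ℕ, RadVanishes A l → m ≤ l

/-- A path of irreducible morphisms between (f.g.) indecomposable modules,
together with its composite morphism and its length. -/
inductive IrrPath : ∀ (M N : ModuleCat.{0} A), (M ⟶ N) → ℕ → Prop
  | nil (M : ModuleCat.{0} A) : FinIndec A M → IrrPath M M (𝟙 M) 0
  | cons {M X N : ModuleCat.{0} A} (f : M ⟶ X) (g : X ⟶ N) (n : ℕ) :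
      FinIndec A M → IrredMor A f → IrrPath X N g n → IrrPath M N (f ≫ g) (n + 1)

/-- The Auslander–Reiten quiver of `A` is a component with length : parallel paths
of irreducible morphisms have the same length. -/
def WithLength : Prop :=
  ∀ (M N : ModuleCat.{0} A) (n m : ℕ),
    (∃ f : M ⟶ N, IrrPath A M N f n) → (∃ g : M ⟶ N, IrrPath A M N g m) → n = m

/-- `N` is a successor of `M` (a path of non-zero morphisms between f.g.
indecomposables from `M` to `N`). -/
inductive Reach : ModuleCat.{0} A → ModuleCat.{0} A → Prop
  | refl (M : ModuleCat.{0} A) : FinIndec A M → Reach M M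
  | cons {M X N : ModuleCat.{0} A} : FinIndec A M → FinIndec A X →
      (∃ f : M ⟶ X, f ≠ 0) → Reach X N → Reach M N

/-- `N` is a direct summand of `M`. -/
def IsSummand (N M : ModuleCat.{0} A) : Prop :=
  ∃ (i : N ⟶ M) (p : M ⟶ N), i ≫ p = 𝟙 N

/-- The radical of a module (intersection of the maximal submodules). -/
def radOf (M : ModuleCat.{0} A) : Submodule A M := sInf {N | IsCoatom N}

/-- The socle of a module (sum of the simple submodules). -/
def socOf (M : ModuleCat.{0} A) : Submodule A M := sSup {N | IsAtom N}

/-- `0 → X → E → Y → 0` is an almost split (Auslander–Reiten) sequence. -/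
def IsAlmostSplit {X E Y : ModuleCat.{0} A} (f : X ⟶ E) (g : E ⟶ Y) : Prop :=
  FinIndec A X ∧ FinIndec A Y ∧ Module.Finite A E ∧
  Function.Injective f ∧ Function.Surjective g ∧
  (∀ x : X, g (f x) = 0) ∧ (∀ e : E, g e = 0 → ∃ x : X, f x = e) ∧
  (¬ ∃ s : Y ⟶ E, s ≫ g = 𝟙 Y) ∧
  (∀ (M : ModuleCat.{0} A) (h : X ⟶ M), (¬ ∃ r : M ⟶ X, h ≫ r = 𝟙 X) →
    ∃ t : E ⟶ M, f ≫ t = h) ∧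
  (∀ (M : ModuleCat.{0} A) (h : M ⟶ Y), (¬ ∃ s : Y ⟶ M, s ≫ h = 𝟙 Y) →
    ∃ t : M ⟶ E, t ≫ g = h)

/-- `X = τ Y` : there is an almost split sequence `0 → X → E → Y → 0`. -/
def IsTauOf (X Y : ModuleCat.{0} A) : Prop :=
  ∃ (E : ModuleCat.{0} A) (f : X ⟶ E) (g : E ⟶ Y), IsAlmostSplit A f g

/-- A sectional path of irreducible morphisms of length `n` from `M` to `N`. -/
def SectionalPath (M N : ModuleCat.{0} A) (n : ℕ) : Prop :=
  ∃ Y : Fin (n + 1) → ModuleCat.{0} A,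
    Y 0 = M ∧ Y (Fin.last n) = N ∧ (∀ i, FinIndec A (Y i)) ∧
    (∀ i : Fin n, ∃ f : Y i.castSucc ⟶ Y i.succ, IrredMor A f) ∧
    ∀ (i : ℕ) (h : i + 2 ≤ n),
      ¬ IsTauOf A (Y ⟨i, by omega⟩) (Y ⟨i + 2, by omega⟩)

end ModuleSide

/-! ## Modules attached to vertices -/

section Vertices

variable {k A V E : Type} [Field k] [Ring A] [Algebra k A] [Fintype V] [Fintype E]

/-- `S` is the simple module at the vertex `a`. -/
def IsSimpleAt (P : QuiverPresentation k A V E) (a : V) (S : ModuleCat.{0} A) : Prop :=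
  IsSimpleModule A S ∧ ∃ x : S, P.idem a • x ≠ 0

/-- `Pm` is the indecomposable projective at the vertex `a`. -/
def IsProjAt (P : QuiverPresentation k A V E) (a : V) (Pm : ModuleCat.{0} A) : Prop :=
  Module.Projective A Pm ∧ FinIndec A Pm ∧
  ∃ (S : ModuleCat.{0} A) (f : Pm ⟶ S), IsSimpleAt P a S ∧ Function.Surjective f

/-- `Im` is the indecomposable injective at the vertex `a`. -/
def IsInjAt (P : QuiverPresentation k A V E) (a : V) (Im : ModuleCat.{0} A) : Prop :=
  Module.Injective A Im ∧ FinIndec A Im ∧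
  ∃ (S : ModuleCat.{0} A) (f : S ⟶ Im), IsSimpleAt P a S ∧ Function.Injective f

/-- `RVal P a n` : `n` is the length of a non-zero path of irreducible morphisms
between indecomposable modules from `P_a` to `I_a` going through `S_a`. -/
def RVal (P : QuiverPresentation k A V E) (a : V) (n : ℕ) : Prop :=
  ∃ (Pm S Im : ModuleCat.{0} A) (f : Pm ⟶ S) (g : S ⟶ Im) (n₁ n₂ : ℕ),
    IsProjAt P a Pm ∧ IsSimpleAt P a S ∧ IsInjAt P a Im ∧
    IrrPath A Pm S f n₁ ∧ IrrPath A S Im g n₂ ∧ f ≫ g ≠ 0 ∧ n = n₁ + n₂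

end Vertices

namespace CategoryTheory.Directed

open Limits Opposite ZeroObject

attribute [local instance] Abelian.hasFiniteBiproducts

section Basic

variable {C : Type*} [Category C]

/-- An indecomposable object, phrased through idempotent endomorphisms. -/
def IsInd [Preadditive C] (X : C) : Prop := ¬ IsZero X ∧ ∀ e : X ⟶ X, e ≫ e = e → e = 0 ∨ e = 𝟙 X

/-- Irreducible morphisms of an abelian category. -/
def IsIrr {X Y : C} (f : X ⟶ Y) : Prop :=
  (¬ ∃ g : Y ⟶ X, f ≫ g = 𝟙 X) ∧ (¬ ∃ g : Y ⟶ X, g ≫ f = 𝟙 Y) ∧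
  ∀ (Z : C) (u : X ⟶ Z) (v : Z ⟶ Y), u ≫ v = f →
    (∃ r : Z ⟶ X, u ≫ r = 𝟙 X) ∨ (∃ s : Y ⟶ Z, s ≫ v = 𝟙 Y)

/-- Every epimorphism onto `X` splits. -/
def EpisSplit (X : C) : Prop := ∀ (Z : C) (p : Z ⟶ X), Epi p → ∃ s : X ⟶ Z, s ≫ p = 𝟙 X

/-- Every monomorphism out of `X` splits. -/
def MonosSplit (X : C) : Prop := ∀ (Z : C) (i : X ⟶ Z), Mono i → ∃ r : Z ⟶ X, i ≫ r = 𝟙 X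

/-- `E` together with `g` is right almost split. -/
def IsRightAlmostSplit {E M : C} (g : E ⟶ M) : Prop :=
  (¬ ∃ s : M ⟶ E, s ≫ g = 𝟙 M) ∧
  ∀ (X : C) (f : X ⟶ M), (¬ ∃ s : M ⟶ X, s ≫ f = 𝟙 M) → ∃ t : X ⟶ E, t ≫ g = f

variable (C) in
/-- A self-dual list of finiteness conditions on an abelian category with finitely many
indecomposable objects, all of which are bricks. -/
structure FiniteBrick [Abelian C] : Prop where
  decomp : ∀ Z : C, ∃ (I : Type) (_ : Fintype I) (X : I → C) (ι : ∀ i, X i ⟶ Z)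
    (π : ∀ i, Z ⟶ X i), (∀ i, IsInd (X i)) ∧ (∀ i, ι i ≫ π i = 𝟙 (X i)) ∧
      ∑ i, π i ≫ ι i = 𝟙 Z
  brick : ∀ X : C, IsInd X → ∀ f : X ⟶ X, f = 0 ∨ IsIso f
  finite : ∃ (n : ℕ) (T : Fin n → C), ∀ X, IsInd X → ∃ i, Nonempty (X ≅ T i)
  gens_left : ∀ X Y : C, ∃ (n : ℕ) (b : Fin n → (X ⟶ Y)), ∀ f : X ⟶ Y,
    ∃ c : Fin n → (X ⟶ X), f = ∑ i, c i ≫ b i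
  gens_right : ∀ X Y : C, ∃ (n : ℕ) (b : Fin n → (X ⟶ Y)), ∀ f : X ⟶ Y,
    ∃ c : Fin n → (Y ⟶ Y), f = ∑ i, b i ≫ c i
  length : ∃ d : C → ℕ, (∀ (X Y : C) (f : X ⟶ Y), Mono f → d Y ≤ d X → IsIso f) ∧
    (∀ (X Y : C) (f : X ⟶ Y), Epi f → d X ≤ d Y → IsIso f)

lemma IsInd.isIso_of_splitMono [Preadditive C] {X Y : C} (hX : IsInd X) (hY : IsInd Y) {f : X ⟶ Y}
    {r : Y ⟶ X} (h : f ≫ r = 𝟙 X) : IsIso f := by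
  rcases hY.2 (r ≫ f) (by simp [reassoc_of% h]) with h0 | h1
  · exfalso
    apply hX.1
    rw [IsZero.iff_id_eq_zero]
    calc 𝟙 X = f ≫ (r ≫ f) ≫ r := by simp [h]
      _ = 0 := by simp [h0]
  · exact ⟨r, h, h1⟩

lemma IsInd.isIso_of_splitEpi [Preadditive C] {X Y : C} (hX : IsInd X) (hY : IsInd Y) {f : X ⟶ Y}
    {s : Y ⟶ X} (h : s ≫ f = 𝟙 Y) : IsIso f := by
  have := hY.isIso_of_splitMono hX h
  have e : f = inv s := by rw [← cancel_epi s, h, IsIso.hom_inv_id]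
  rw [e]; infer_instance

lemma IsIrr.ne_zero [Abelian C] {X Y : C} {f : X ⟶ Y} (hf : IsIrr f) : f ≠ 0 := by
  rintro rfl
  rcases hf.2.2 0 (0 : X ⟶ 0) (0 : (0 : C) ⟶ Y) (by simp) with ⟨r, hr⟩ | ⟨s, hs⟩
  · exact hf.1 ⟨0, by simpa using hr⟩
  · exact hf.2.1 ⟨0, by simpa using hs⟩

lemma IsIrr.not_isIso {X Y : C} {f : X ⟶ Y} (hf : IsIrr f) : ¬ IsIso f :=
  fun _ => hf.1 ⟨inv f, IsIso.hom_inv_id f⟩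

end Basic

section Duality

variable {C : Type*} [Category C]

lemma isInd_op [Preadditive C] {X : C} : IsInd (op X) ↔ IsInd X := by
  constructor
  · rintro ⟨h1, h2⟩
    refine ⟨fun h => h1 h.op, fun e he => ?_⟩
    rcases h2 e.op (by rw [← op_comp, he]) with h | h
    · left; exact Quiver.Hom.op_inj (by simpa using h)
    · right; exact Quiver.Hom.op_inj (by simpa using h)
  · rintro ⟨h1, h2⟩
    refine ⟨fun h => h1 h.unop, fun e he => ?_⟩
    rcases h2 e.unop (by rw [← unop_comp, he]) with h | h
    · left; exact Quiver.Hom.unop_inj (by simpa using h)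
    · right; exact Quiver.Hom.unop_inj (by simpa using h)

lemma isIrr_unop {X Y : Cᵒᵖ} {f : X ⟶ Y} (hf : IsIrr f) : IsIrr f.unop := by
  refine ⟨fun ⟨g, hg⟩ => hf.2.1 ⟨g.op, Quiver.Hom.unop_inj hg⟩,
    fun ⟨g, hg⟩ => hf.1 ⟨g.op, Quiver.Hom.unop_inj hg⟩, fun Z u v h => ?_⟩
  rcases hf.2.2 (op Z) v.op u.op (Quiver.Hom.unop_inj h) with ⟨r, hr⟩ | ⟨s, hs⟩
  · exact Or.inr ⟨r.unop, Quiver.Hom.op_inj hr⟩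
  · exact Or.inl ⟨s.unop, Quiver.Hom.op_inj hs⟩

lemma isIrr_op {X Y : C} {f : X ⟶ Y} (hf : IsIrr f) : IsIrr f.op := by
  refine ⟨fun ⟨g, hg⟩ => hf.2.1 ⟨g.unop, Quiver.Hom.op_inj hg⟩,
    fun ⟨g, hg⟩ => hf.1 ⟨g.unop, Quiver.Hom.op_inj hg⟩, fun Z u v h => ?_⟩
  rcases hf.2.2 (unop Z) v.unop u.unop (Quiver.Hom.op_inj h) with ⟨r, hr⟩ | ⟨s, hs⟩
  · exact Or.inr ⟨r.op, Quiver.Hom.unop_inj hr⟩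
  · exact Or.inl ⟨s.op, Quiver.Hom.unop_inj hs⟩

lemma FiniteBrick.dual [Abelian C] (H : FiniteBrick C) : FiniteBrick Cᵒᵖ where
  decomp Z := by
    obtain ⟨I, hI, X, ι, π, h1, h2, h3⟩ := H.decomp Z.unop
    refine ⟨I, hI, fun i => op (X i), fun i => (π i).op, fun i => (ι i).op,
      fun i => isInd_op.2 (h1 i), fun i => ?_, ?_⟩
    · rw [← op_comp, h2]; rfl
    · apply Quiver.Hom.unop_inj
      simpa [unop_sum] using h3
  brick X hX f := by
    rcases H.brick X.unop (isInd_op.1 hX) f.unop with h | h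
    · left; exact Quiver.Hom.unop_inj (by simpa using h)
    · right; exact (isIso_unop_iff f).1 h
  finite := by
    obtain ⟨n, T, h⟩ := H.finite
    refine ⟨n, fun i => op (T i), fun X hX => ?_⟩
    obtain ⟨i, ⟨e⟩⟩ := h X.unop (isInd_op.1 hX)
    exact ⟨i, ⟨e.symm.op⟩⟩
  gens_left X Y := by
    obtain ⟨n, b, h⟩ := H.gens_right Y.unop X.unop
    refine ⟨n, fun i => (b i).op, fun f => ?_⟩
    obtain ⟨c, hc⟩ := h f.unop
    refine ⟨fun i => (c i).op, Quiver.Hom.unop_inj ?_⟩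
    simpa [unop_sum] using hc
  gens_right X Y := by
    obtain ⟨n, b, h⟩ := H.gens_left Y.unop X.unop
    refine ⟨n, fun i => (b i).op, fun f => ?_⟩
    obtain ⟨c, hc⟩ := h f.unop
    refine ⟨fun i => (c i).op, Quiver.Hom.unop_inj ?_⟩
    simpa [unop_sum] using hc
  length := by
    obtain ⟨d, h1, h2⟩ := H.length
    refine ⟨fun X => d X.unop, fun X Y f hf h => ?_, fun X Y f hf h => ?_⟩
    · exact (isIso_unop_iff f).1 (h2 _ _ f.unop inferInstance h)
    · exact (isIso_unop_iff f).1 (h1 _ _ f.unop inferInstance h)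

end Duality

section AlmostSplit

variable {C : Type*} [Category C] [Abelian C]

/-- If a sum of endomorphisms through `X i` is the identity of `M`, some summand is invertible. -/
lemma FiniteBrick.exists_isIso_of_sum (H : FiniteBrick C) {M : C} (hM : IsInd M) {I : Type*}
    [Fintype I] (f : I → (M ⟶ M)) (hf : ∑ i, f i = 𝟙 M) : ∃ i, IsIso (f i) := by
  by_contra! hn
  have h0 : ∀ i, f i = 0 := fun i => (H.brick M hM (f i)).resolve_right (hn i)
  apply hM.1
  rw [IsZero.iff_id_eq_zero, ← hf]
  simp [h0]

lemma FiniteBrick.exists_isRightAlmostSplit (H : FiniteBrick C) {M : C} (hM : IsInd M) :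
    ∃ (E : C) (g : E ⟶ M), IsRightAlmostSplit g := by
  obtain ⟨n, T, hT⟩ := H.finite
  choose m b hb using fun X : C => H.gens_left X M
  let J := Σ i : {i : Fin n // IsInd (T i) ∧ ¬ Nonempty (T i ≅ M)}, Fin (m (T i))
  let F : J → C := fun j => T j.1
  let g : (⨁ F) ⟶ M := biproduct.desc fun j => b (T j.1) j.2
  refine ⟨⨁ F, g, ?_, ?_⟩
  · rintro ⟨s, hs⟩
    have : ∑ j, (s ≫ biproduct.π F j) ≫ biproduct.ι F j ≫ g = 𝟙 M := by
      rw [← hs]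
      conv_rhs => rw [← Category.id_comp g, ← biproduct.total, Preadditive.sum_comp,
        Preadditive.comp_sum]
      simp
    obtain ⟨j, hj⟩ := H.exists_isIso_of_sum hM _ this
    apply j.1.2.2
    have := j.1.2.1.isIso_of_splitEpi hM (f := biproduct.ι F j ≫ g)
      (s := inv ((s ≫ biproduct.π F j) ≫ biproduct.ι F j ≫ g) ≫ s ≫ biproduct.π F j)
      (by simp only [Category.assoc, IsIso.inv_hom_id])
    exact ⟨asIso (biproduct.ι F j ≫ g)⟩
  · intro X f hf
    obtain ⟨I, hI, Z, ι, π, h1, h2, h3⟩ := H.decomp X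
    have key : ∀ i, ∃ t : Z i ⟶ ⨁ F, t ≫ g = ι i ≫ f := by
      intro i
      obtain ⟨l, ⟨e⟩⟩ := hT (Z i) (h1 i)
      by_cases hl : Nonempty (T l ≅ M)
      · obtain ⟨e'⟩ := hl
        rcases H.brick M hM (e'.inv ≫ e.inv ≫ ι i ≫ f) with h | h
        · refine ⟨0, ?_⟩
          have : ι i ≫ f = 0 := by
            rw [← cancel_epi e.inv, ← cancel_epi e'.inv, h]; simp
          simp [this]
        · exfalso
          apply hf
          refine ⟨inv (e'.inv ≫ e.inv ≫ ι i ≫ f) ≫ e'.inv ≫ e.inv ≫ ι i, ?_⟩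
          simp only [Category.assoc, IsIso.inv_hom_id]
      · have hTl : IsInd (T l) := by
          refine ⟨fun hz => (h1 i).1 (hz.of_iso e), fun x hx => ?_⟩
          rcases (h1 i).2 (e.hom ≫ x ≫ e.inv) (by simp [reassoc_of% hx]) with h | h
          · left
            rw [← cancel_epi e.hom, ← cancel_mono e.inv]; simpa using h
          · right
            rw [← cancel_epi e.hom, ← cancel_mono e.inv]; simpa using h
        obtain ⟨c, hc⟩ := hb (T l) (e.inv ≫ ι i ≫ f)
        let l' : {i : Fin n // IsInd (T i) ∧ ¬ Nonempty (T i ≅ M)} := ⟨l, hTl, hl⟩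
        refine ⟨e.hom ≫ ∑ x : Fin (m (T l)), c x ≫ biproduct.ι F ⟨l', x⟩, ?_⟩
        rw [← cancel_epi e.inv, hc]
        simp only [Category.assoc, e.inv_hom_id_assoc, Preadditive.sum_comp]
        refine Finset.sum_congr rfl fun x _ => ?_
        simp only [g, biproduct.ι_desc]
        rfl
    choose t ht using key
    refine ⟨∑ i, π i ≫ t i, ?_⟩
    calc (∑ i, π i ≫ t i) ≫ g = ∑ i, (π i ≫ ι i) ≫ f := by
          simp [Preadditive.sum_comp, ht]
      _ = f := by rw [← Preadditive.sum_comp, h3, Category.id_comp]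

/-- Minimal right almost split morphisms exist. -/
lemma FiniteBrick.exists_minimal (H : FiniteBrick C) {M : C} (hM : IsInd M) :
    ∃ (E : C) (g : E ⟶ M), IsRightAlmostSplit g ∧ ∀ φ : E ⟶ E, φ ≫ g = g → IsIso φ := by
  obtain ⟨d, hd1, hd2⟩ := H.length
  have hex : ∃ (n : ℕ) (E : C) (g : E ⟶ M), IsRightAlmostSplit g ∧ d E = n := by
    obtain ⟨E, g, hg⟩ := H.exists_isRightAlmostSplit hM
    exact ⟨_, E, g, hg, rfl⟩
  obtain ⟨E, g, hg, hE⟩ := Nat.find_spec hex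
  refine ⟨E, g, hg, fun φ hφ => ?_⟩
  have h1 : IsRightAlmostSplit (image.ι φ ≫ g) := by
    refine ⟨fun ⟨s, hs⟩ => hg.1 ⟨s ≫ image.ι φ, by simpa using hs⟩, fun X f hf => ?_⟩
    obtain ⟨t, ht⟩ := hg.2 X f hf
    exact ⟨t ≫ factorThruImage φ, by simp [hφ, ht]⟩
  have h2 : d E ≤ d (image φ) := by
    rw [hE]; exact Nat.find_min' hex ⟨_, _, h1, rfl⟩
  have h3 := hd1 _ _ (image.ι φ) inferInstance
  have h4 := hd2 _ _ (factorThruImage φ) inferInstance h2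
  have h5 : Mono φ := by
    rw [← image.fac φ]; infer_instance
  exact hd1 _ _ φ h5 le_rfl

end AlmostSplit

section Translate

variable {C : Type*} [Category C] [Abelian C]

/-- A morphism out of the kernel of an epimorphism extends along the kernel, or else the pushed out
short exact sequence produces a nonsplit epimorphism. -/
lemma exists_extension_or_nonsplit {E M X : C} (g : E ⟶ M) [Epi g] (h : kernel g ⟶ X) :
    (∃ t : E ⟶ X, kernel.ι g ≫ t = h) ∨
      ∃ (Y : C) (inl : E ⟶ Y) (inr : X ⟶ Y) (p : Y ⟶ M), kernel.ι g ≫ inl = h ≫ inr ∧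
        inl ≫ p = g ∧ inr ≫ p = 0 ∧ ¬ ∃ s : M ⟶ Y, s ≫ p = 𝟙 M := by
  let p : pushout (kernel.ι g) h ⟶ M := pushout.desc g 0 (by simp)
  have hinr : pushout.inr (kernel.ι g) h ≫ p = 0 := pushout.inr_desc _ _ _
  have hinl : pushout.inl (kernel.ι g) h ≫ p = g := pushout.inl_desc _ _ _
  by_cases hs : ∃ s : M ⟶ pushout (kernel.ι g) h, s ≫ p = 𝟙 M
  · left
    obtain ⟨s, hs⟩ := hs
    have hc : IsColimit (CokernelCofork.ofπ p hinr) := by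
      have hep : Epi p := by
        have : Epi (pushout.inl (kernel.ι g) h ≫ p) := by rw [hinl]; infer_instance
        exact epi_of_epi (pushout.inl (kernel.ι g) h) p
      have hz : ∀ {W : C} (w : pushout (kernel.ι g) h ⟶ W), pushout.inr (kernel.ι g) h ≫ w = 0 →
          kernel.ι g ≫ pushout.inl (kernel.ι g) h ≫ w = 0 := fun w hw => by
        rw [pushout.condition_assoc, hw, comp_zero]
      have hfac : ∀ {W : C} (w : pushout (kernel.ι g) h ⟶ W)
          (hw : pushout.inr (kernel.ι g) h ≫ w = 0), p ≫ Abelian.epiDesc g _ (hz w hw) = w := by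
        intro W w hw
        apply pushout.hom_ext
        · rw [reassoc_of% hinl, Abelian.comp_epiDesc]
        · rw [← Category.assoc, hinr, hw, zero_comp]
      exact CokernelCofork.IsColimit.ofπ _ _ (fun w hw => Abelian.epiDesc g _ (hz w hw))
        (fun w hw => hfac w hw) fun w hw m hm => by rw [← cancel_epi p, hm, hfac w hw]
    have hk := Abelian.monoIsKernelOfCokernel _ hc
    have hz : (pushout.inl (kernel.ι g) h - g ≫ s) ≫ p = 0 := by
      simp [Preadditive.sub_comp, hinl, hs]
    refine ⟨hk.lift (KernelFork.ofι (pushout.inl (kernel.ι g) h - g ≫ s) hz), ?_⟩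
    have hl : hk.lift (KernelFork.ofι (pushout.inl (kernel.ι g) h - g ≫ s) hz) ≫
        pushout.inr (kernel.ι g) h = pushout.inl (kernel.ι g) h - g ≫ s :=
      hk.fac _ WalkingParallelPair.zero
    rw [← cancel_mono (pushout.inr (kernel.ι g) h), Category.assoc, hl]
    simp [Preadditive.comp_sub, pushout.condition]
  · right
    exact ⟨_, pushout.inl _ _, pushout.inr _ _, p, pushout.condition, hinl, hinr, hs⟩

/-- The Auslander-Reiten translate of a nonprojective indecomposable, with the properties of the
almost split sequence which are needed below. -/
lemma FiniteBrick.exists_tau (H : FiniteBrick C) {M : C} (hM : IsInd M) (hnp : ¬ EpisSplit M) :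
    ∃ K : C, IsInd K ∧ ∀ Y : C, IsInd Y → (∃ a : Y ⟶ M, IsIrr a) →
      (∃ b : K ⟶ Y, IsIrr b) ∧
      ∀ (Z : C) (c : Z ⟶ Y), c ≠ 0 → (∃ f : Z ⟶ M, f ≠ 0) ∨ ∃ f : Z ⟶ K, f ≠ 0 := by
  obtain ⟨d, hd1, -⟩ := H.length
  obtain ⟨E, g, hg, hmin⟩ := H.exists_minimal hM
  have hepi : Epi g := by
    simp only [EpisSplit, not_forall] at hnp
    obtain ⟨Z, p, hp, hn⟩ := hnp
    obtain ⟨t, rfl⟩ := hg.2 Z p hn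
    exact epi_of_epi t g
  have hret : ¬ ∃ ρ : E ⟶ kernel g, kernel.ι g ≫ ρ = 𝟙 _ := by
    rintro ⟨ρ, hρ⟩
    have hz : kernel.ι g ≫ (𝟙 E - ρ ≫ kernel.ι g) = 0 := by
      simp [Preadditive.comp_sub, reassoc_of% hρ]
    let s := Abelian.epiDesc g (𝟙 E - ρ ≫ kernel.ι g) hz
    have hs : g ≫ s = 𝟙 E - ρ ≫ kernel.ι g := Abelian.comp_epiDesc g _ hz
    refine hg.1 ⟨s, ?_⟩
    rw [← cancel_epi g, reassoc_of% hs]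
    simp [Preadditive.sub_comp]
  have hext : ∀ (X : C) (h : kernel g ⟶ X), (¬ ∃ r : X ⟶ kernel g, h ≫ r = 𝟙 _) →
      ∃ t : E ⟶ X, kernel.ι g ≫ t = h := by
    intro X h hh
    rcases exists_extension_or_nonsplit g h with ht | ⟨Y, inl, inr, p, h1, h2, h3, h4⟩
    · exact ht
    exfalso
    obtain ⟨t, ht⟩ := hg.2 Y p h4
    have hφ := hmin (inl ≫ t) (by rw [Category.assoc, ht, h2])
    have hu0 : (inr ≫ t) ≫ g = 0 := by rw [Category.assoc, ht, h3]
    have hv0 : (kernel.ι g ≫ inv (inl ≫ t)) ≫ g = 0 := by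
      have : inv (inl ≫ t) ≫ g = g := by
        rw [IsIso.inv_comp_eq, Category.assoc, ht, h2]
      rw [Category.assoc, this, kernel.condition]
    refine hh ⟨kernel.lift g _ hu0 ≫ kernel.lift g _ hv0, ?_⟩
    rw [← cancel_mono (kernel.ι g)]
    simp only [Category.assoc, kernel.lift_ι, kernel.lift_ι_assoc, Category.id_comp]
    rw [← reassoc_of% h1, ← Category.assoc inl t, IsIso.hom_inv_id, Category.comp_id]
  have hK : IsInd (kernel g) := by
    refine ⟨fun hz => ?_, fun e he => ?_⟩
    · have hm : Mono g := Preadditive.mono_of_kernel_zero (hz.eq_of_src _ _)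
      have := isIso_of_mono_of_epi g
      exact hg.1 ⟨inv g, IsIso.inv_hom_id g⟩
    · by_contra! hn
      have key : ∀ f : kernel g ⟶ kernel g, f ≫ f = f → f ≠ 𝟙 _ →
          ¬ ∃ r : kernel g ⟶ kernel g, f ≫ r = 𝟙 _ := by
        rintro f hf hf1 ⟨r, hr⟩
        apply hf1
        calc f = f ≫ (f ≫ r) := by rw [hr, Category.comp_id]
          _ = 𝟙 _ := by rw [reassoc_of% hf, hr]
      obtain ⟨t, ht⟩ := hext _ e (key e he hn.2)
      obtain ⟨t', ht'⟩ := hext _ (𝟙 _ - e) (key (𝟙 _ - e)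
        (by simp [Preadditive.comp_sub, Preadditive.sub_comp, he])
        (fun h => hn.1 (by simpa using h)))
      exact hret ⟨t + t', by simp [Preadditive.comp_add, ht, ht']⟩
  have hlmin : ∀ φ : E ⟶ E, kernel.ι g ≫ φ = kernel.ι g → IsIso φ := by
    intro φ hφ
    have hz : kernel.ι g ≫ φ ≫ g = 0 := by rw [reassoc_of% hφ, kernel.condition]
    have hψ : g ≫ Abelian.epiDesc g (φ ≫ g) hz = φ ≫ g := Abelian.comp_epiDesc g _ hz
    rcases H.brick M hM (Abelian.epiDesc g (φ ≫ g) hz) with h0 | hi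
    · exfalso
      rw [h0, comp_zero] at hψ
      refine hret ⟨kernel.lift g φ hψ.symm, ?_⟩
      rw [← cancel_mono (kernel.ι g)]
      simp [hφ]
    · refine hd1 _ _ φ ?_ le_rfl
      refine Preadditive.mono_of_cancel_zero _ fun {W} w hw => ?_
      have hwg : w ≫ g = 0 := by
        rw [← cancel_mono (Abelian.epiDesc g (φ ≫ g) hz), Category.assoc, hψ, reassoc_of% hw]
        simp
      have hw' : kernel.lift g w hwg ≫ kernel.ι g = w := kernel.lift_ι _ _ _
      rw [← hw', ← hφ, ← Category.assoc, hw', hw]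
  refine ⟨kernel g, hK, fun Y hY ⟨a, ha⟩ => ?_⟩
  obtain ⟨i, hi⟩ := hg.2 Y a ha.2.1
  obtain ⟨q, hq⟩ : ∃ q : E ⟶ Y, i ≫ q = 𝟙 Y :=
    (ha.2.2 E i g hi).resolve_right hg.1
  constructor
  · have hns : ¬ ∃ r : Y ⟶ kernel g, (kernel.ι g ≫ q) ≫ r = 𝟙 _ := by
      rintro ⟨r, hr⟩
      exact hret ⟨q ≫ r, by simpa using hr⟩
    refine ⟨kernel.ι g ≫ q, hns, ?_, fun Z u v huv => ?_⟩
    · rintro ⟨s, hs⟩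
      have := hK.isIso_of_splitEpi hY hs
      exact hns ⟨inv (kernel.ι g ≫ q), IsIso.hom_inv_id _⟩
    · by_cases hu : ∃ r : Z ⟶ kernel g, u ≫ r = 𝟙 _
      · exact Or.inl hu
      right
      obtain ⟨w, hw⟩ := hext Z u hu
      have hφ := hlmin (𝟙 E - q ≫ i + w ≫ v ≫ i) (by
        simp only [Preadditive.comp_add, Preadditive.comp_sub, Category.comp_id, reassoc_of% hw,
          reassoc_of% huv]
        simp)
      have h1 : (𝟙 E - q ≫ i + w ≫ v ≫ i) ≫ q = w ≫ v := by
        simp [Preadditive.add_comp, Preadditive.sub_comp, hq]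
      refine ⟨i ≫ inv (𝟙 E - q ≫ i + w ≫ v ≫ i) ≫ w, ?_⟩
      simp only [Category.assoc]
      rw [← h1, IsIso.inv_hom_id_assoc, hq]
  · intro Z c hc
    by_cases h0 : c ≫ i ≫ g = 0
    · right
      refine ⟨kernel.lift g (c ≫ i) (by simpa using h0), fun h => hc ?_⟩
      have h1 : kernel.lift g (c ≫ i) (by simpa using h0) ≫ kernel.ι g = c ≫ i :=
        kernel.lift_ι _ _ _
      rw [h, zero_comp] at h1
      rw [← Category.comp_id c, ← hq, ← Category.assoc, ← h1, zero_comp]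
    · exact Or.inl ⟨_, h0⟩

lemma FiniteBrick.exists_tauInv (H : FiniteBrick C) {X : C} (hX : IsInd X)
    (hni : ¬ MonosSplit X) :
    ∃ N : C, IsInd N ∧ ∀ Y : C, IsInd Y → (∃ a : X ⟶ Y, IsIrr a) →
      (∃ b : Y ⟶ N, IsIrr b) ∧
      ∀ (Z : C) (c : Y ⟶ Z), c ≠ 0 → (∃ f : X ⟶ Z, f ≠ 0) ∨ ∃ f : N ⟶ Z, f ≠ 0 := by
  have hne : ¬ EpisSplit (op X) := by
    intro h
    apply hni
    intro Z i hi
    obtain ⟨s, hs⟩ := h (op Z) i.op inferInstance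
    exact ⟨s.unop, Quiver.Hom.op_inj hs⟩
  obtain ⟨K, hK, h⟩ := H.dual.exists_tau (isInd_op.2 hX) hne
  refine ⟨K.unop, isInd_op.1 hK, fun Y hY ⟨a, ha⟩ => ?_⟩
  obtain ⟨⟨b, hb⟩, h2⟩ := h (op Y) (isInd_op.2 hY) ⟨a.op, isIrr_op ha⟩
  refine ⟨⟨b.unop, isIrr_unop hb⟩, fun Z c hc => ?_⟩
  rcases h2 (op Z) c.op (fun h => hc (Quiver.Hom.op_inj (by simpa using h))) with ⟨f, hf⟩ | ⟨f, hf⟩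
  · exact Or.inl ⟨f.unop, fun h => hf (Quiver.Hom.unop_inj (by simpa using h))⟩
  · exact Or.inr ⟨f.unop, fun h => hf (Quiver.Hom.unop_inj (by simpa using h))⟩

end Translate

section Paths

open Relation

variable {C : Type*} [Category C] [Abelian C]

/-- There is a nonzero morphism between the indecomposables `X` and `Y`. -/
def NZ (X Y : C) : Prop := IsInd X ∧ IsInd Y ∧ ∃ f : X ⟶ Y, f ≠ 0

/-- There is an irreducible morphism between the indecomposables `X` and `Y`. -/
def Arr (X Y : C) : Prop := IsInd X ∧ IsInd Y ∧ ∃ f : X ⟶ Y, IsIrr f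

/-- There is a nonzero nonisomorphism between the indecomposables `X` and `Y`. -/
def Step (X Y : C) : Prop := IsInd X ∧ IsInd Y ∧ ∃ f : X ⟶ Y, f ≠ 0 ∧ ¬ IsIso f

variable (C) in
/-- No nonzero nonisomorphism closes up to a cycle of nonzero morphisms. -/
def Acyclic : Prop := ∀ X Y : C, ReflTransGen NZ X Y → ¬ Step Y X

lemma Step.nz {X Y : C} (h : Step X Y) : NZ X Y :=
  ⟨h.1, h.2.1, h.2.2.imp fun _ hf => hf.1⟩

lemma Arr.step {X Y : C} (h : Arr X Y) : Step X Y :=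
  ⟨h.1, h.2.1, h.2.2.imp fun _ hf => ⟨hf.ne_zero, hf.not_isIso⟩⟩

lemma reflTransGen_nz_of_arr {X Y : C} (h : ReflTransGen Arr X Y) : ReflTransGen NZ X Y :=
  ReflTransGen.mono (fun _ _ h => h.step.nz) _ _ h

lemma IsInd.of_iso {X Y : C} (hX : IsInd X) (e : X ≅ Y) : IsInd Y := by
  refine ⟨fun hz => hX.1 (hz.of_iso e), fun x hx => ?_⟩
  rcases hX.2 (e.hom ≫ x ≫ e.inv) (by simp [reassoc_of% hx]) with h | h
  · left
    rw [← cancel_epi e.hom, ← cancel_mono e.inv]; simpa using h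
  · right
    rw [← cancel_epi e.hom, ← cancel_mono e.inv]; simpa using h

/-- Following a path of irreducible morphisms starting at `X`, either one reaches its end or one
is stopped at an injective object by a nonzero morphism from `X`. -/
lemma FiniteBrick.exists_nz_of_path (H : FiniteBrick C) {X T : C} (hp : ReflTransGen Arr X T) :
    ∀ V : C, Arr X V → ¬ ReflTransGen NZ V T →
      ∃ Z : C, NZ X Z ∧ ReflTransGen NZ Z T ∧ (Z = T ∨ MonosSplit Z) := by
  have hself : ∀ Y : C, IsInd Y → NZ Y Y := fun Y hY =>
    ⟨hY, hY, 𝟙 Y, fun h => hY.1 ((IsZero.iff_id_eq_zero Y).2 h)⟩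
  induction hp using ReflTransGen.head_induction_on with
  | refl => exact fun V hV _ => ⟨T, hself T hV.1, .refl, Or.inl rfl⟩
  | @head X X' hXX' hX'T ih =>
    intro V hV hVT
    by_cases hinj : MonosSplit X
    · exact ⟨X, hself X hV.1, reflTransGen_nz_of_arr (.head hXX' hX'T), Or.inr hinj⟩
    obtain ⟨N, hN, h⟩ := H.exists_tauInv hV.1 hinj
    have hX' := h X' hXX'.2.1 hXX'.2.2
    have hNT : ¬ ReflTransGen NZ N T := fun hNT =>
      hVT (.head (Arr.step ⟨hV.2.1, hN, (h V hV.2.1 hV.2.2).1⟩).nz hNT)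
    obtain ⟨Z, hZ1, hZ2, hZ3⟩ := ih N ⟨hXX'.2.1, hN, hX'.1⟩ hNT
    obtain ⟨-, hZ, c, hc⟩ := hZ1
    refine ⟨Z, ?_, hZ2, hZ3⟩
    rcases hX'.2 Z c hc with hf | hf
    · exact ⟨hV.1, hZ, hf⟩
    · exact absurd (.head ⟨hN, hZ, hf⟩ hZ2) hNT

/-- If `W ⟶ Q` is an irreducible monomorphism and `X` is not reachable from `Q`, then a path of
irreducible morphisms from `W` to `X` forces a nonzero morphism. -/
lemma FiniteBrick.nz_of_irr_mono (H : FiniteBrick C) {W Q X : C} (hW : IsInd W) (hQ : IsInd Q)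
    (f : W ⟶ Q) [Mono f] (hf : IsIrr f) (hp : ReflTransGen Arr W X)
    (hn : ¬ ReflTransGen NZ Q X) : NZ W X := by
  obtain ⟨Z, hZ1, hZ2, rfl | hZ3⟩ := H.exists_nz_of_path hp Q ⟨hW, hQ, f, hf⟩ hn
  · exact hZ1
  · exfalso
    obtain ⟨-, hZ, c, hc⟩ := hZ1
    obtain ⟨r, hr⟩ := hZ3 _ (pushout.inr f c) inferInstance
    refine hn (.head ⟨hQ, hZ, pushout.inl f c ≫ r, fun h0 => hc ?_⟩ hZ2)
    rw [← Category.comp_id c, ← hr, ← pushout.condition_assoc, h0, comp_zero]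

/-- The descent along Auslander-Reiten translates. -/
lemma FiniteBrick.descent (H : FiniteBrick C) {P R : C} (hP : EpisSplit P)
    (hRP : Arr R P)
    (hfin : ∀ Q W X : C, EpisSplit Q → Arr W Q → Arr X Q → ¬ TransGen Arr W X)
    {Y : C} (hY : ReflTransGen Arr P Y) :
    ∀ W : C, Arr W Y → ReflTransGen Arr W R → (Y = P → TransGen Arr W R) → False := by
  induction hY with
  | refl => exact fun W hW _ h => hfin P W R hP hW hRP (h rfl)
  | @tail Y₁ Y hPY₁ hY₁Y ih =>
    intro W hWY hWR hT
    have hRY : TransGen Arr R Y₁ := (TransGen.single hRP).trans_left hPY₁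
    by_cases hpY : EpisSplit Y
    · exact hfin Y W Y₁ hpY hWY hY₁Y (hRY.trans_right hWR)
    obtain ⟨K, hK, h⟩ := H.exists_tau hWY.2.1 hpY
    have hKW : Arr K W := ⟨hK, hWY.1, (h W hWY.1 hWY.2.2).1⟩
    have hKR : TransGen Arr K R := (TransGen.single hKW).trans_left hWR
    exact ih K ⟨hK, hY₁Y.1, (h Y₁ hY₁Y.1 hY₁Y.2.2).1⟩ hKR.to_reflTransGen fun _ => hKR

/-- An irreducible morphism into an indecomposable restricts to an irreducible morphism on some
indecomposable summand. -/
lemma FiniteBrick.exists_irr_summand (H : FiniteBrick C) {R M : C} (hM : IsInd M) {f : R ⟶ M}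
    (hf : IsIrr f) : ∃ (R' : C) (i : R' ⟶ R) (p : R ⟶ R'), IsInd R' ∧ i ≫ p = 𝟙 R' ∧
      IsIrr (i ≫ f) := by
  obtain ⟨I, hI, X, ι, π, h1, h2, h3⟩ := H.decomp R
  obtain ⟨j⟩ : Nonempty I := by
    by_contra h
    rw [not_nonempty_iff] at h
    apply hf.ne_zero
    rw [← Category.id_comp f, ← h3]
    simp
  have hnse : ¬ ∃ s : M ⟶ X j, s ≫ ι j ≫ f = 𝟙 M := fun ⟨s, hs⟩ =>
    hf.2.1 ⟨s ≫ ι j, by simpa using hs⟩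
  refine ⟨X j, ι j, π j, h1 j, h2 j, ?_, hnse, fun Z u v huv => ?_⟩
  · rintro ⟨r, hr⟩
    have := (h1 j).isIso_of_splitMono hM hr
    exact hnse ⟨inv (ι j ≫ f), IsIso.inv_hom_id _⟩
  · rcases hf.2.2 (Z ⊞ R) (biprod.lift (π j ≫ u) (𝟙 R - π j ≫ ι j)) (biprod.desc v f) (by
      simp [huv, Preadditive.sub_comp]) with ⟨r, hr⟩ | ⟨s, hs⟩
    · left
      refine ⟨biprod.inl ≫ r ≫ π j, ?_⟩
      have e : biprod.lift (π j ≫ u) (𝟙 R - π j ≫ ι j) =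
          π j ≫ u ≫ biprod.inl + (𝟙 R - π j ≫ ι j) ≫ biprod.inr := by
        ext <;> simp
      have := congrArg (fun x => ι j ≫ x ≫ π j) hr
      simpa [e, Preadditive.add_comp, Preadditive.comp_add, Preadditive.sub_comp,
        Preadditive.comp_sub, reassoc_of% (h2 j), h2 j] using this
    · right
      have e : s ≫ biprod.desc v f = (s ≫ biprod.fst) ≫ v + (s ≫ biprod.snd) ≫ f := by
        conv_lhs => rw [← Category.comp_id s, ← biprod.total]
        simp only [Preadditive.comp_add, Preadditive.add_comp, Category.assoc, biprod.inl_desc,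
          biprod.inr_desc]
      rw [e] at hs
      rcases H.brick M hM ((s ≫ biprod.fst) ≫ v) with h0 | hi
      · rw [h0, zero_add] at hs
        exact absurd ⟨_, hs⟩ hf.2.1
      · exact ⟨inv ((s ≫ biprod.fst) ≫ v) ≫ s ≫ biprod.fst, by
          rw [Category.assoc, IsIso.inv_hom_id]⟩

end Paths

section Fitting

/-- Fitting's lemma for a finite-dimensional algebra without nontrivial idempotents. -/
lemma isUnit_or_isNilpotent (k : Type*) {B : Type*} [Field k] [Ring B] [Algebra k B]
    [FiniteDimensional k B] (h : ∀ e : B, e * e = e → e = 0 ∨ e = 1) (f : B) :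
    IsUnit f ∨ IsNilpotent f := by
  obtain ⟨n, hn1, hn⟩ := ((Filter.eventually_ge_atTop 1).and
    (LinearMap.eventually_isCompl_ker_pow_range_pow (LinearMap.mulLeft k f))).exists
  rw [LinearMap.pow_mulLeft] at hn
  obtain ⟨a, ha, b, hb, hab⟩ := Submodule.mem_sup.1
    ((hn.sup_eq_top ▸ Submodule.mem_top : (1 : B) ∈ _))
  obtain ⟨c, hc⟩ := hb
  rw [LinearMap.mem_ker] at ha
  simp only [LinearMap.mulLeft_apply] at ha hc
  have hba : b * a = 0 := by
    have h1 : b * a ∈ LinearMap.range (LinearMap.mulLeft k (f ^ n)) :=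
      ⟨c * a, by simp [← hc, mul_assoc]⟩
    have h2 : b * a ∈ LinearMap.ker (LinearMap.mulLeft k (f ^ n)) := by
      have : b * a = a - a * a := by
        rw [eq_sub_of_add_eq' hab, sub_mul, one_mul]
      rw [LinearMap.mem_ker, this, LinearMap.mulLeft_apply, mul_sub, ← mul_assoc, ha]
      simp
    exact Submodule.disjoint_def.1 hn.disjoint _ h2 h1
  have haa : a * a = a := by
    calc a * a = (a + b) * a := by rw [add_mul, hba, add_zero]
      _ = a := by rw [hab, one_mul]
  rcases h a haa with rfl | rfl
  · left
    rw [zero_add] at hab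
    have : Subsingleton B ∨ Nontrivial B := subsingleton_or_nontrivial B
    have h1 : f * (f ^ (n - 1) * c) = 1 := by
      rw [← mul_assoc, ← pow_succ', Nat.sub_add_cancel hn1, hc, hab]
    have := IsArtinianRing.of_finite k B
    exact IsUnit.of_mul_eq_one _ h1
  · right
    exact ⟨n, by simpa using ha⟩

end Fitting

section Linear

open Relation

variable (k : Type*) [Field k] {C : Type*} [Category C] [Abelian C] [Linear k C]

/-- Krull-Schmidt decompositions, by induction on the dimension of the endomorphism algebra. -/
lemma exists_decomp [∀ X Y : C, FiniteDimensional k (X ⟶ Y)] (Z : C) :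
    ∃ (I : Type) (_ : Fintype I) (X : I → C) (ι : ∀ i, X i ⟶ Z)
    (π : ∀ i, Z ⟶ X i), (∀ i, IsInd (X i)) ∧ (∀ i, ι i ≫ π i = 𝟙 (X i)) ∧
      ∑ i, π i ≫ ι i = 𝟙 Z := by
  induction hn : Module.finrank k (Z ⟶ Z) using Nat.strong_induction_on generalizing Z with
  | _ n ih =>
  subst hn
  by_cases hz : IsZero Z
  · exact ⟨Empty, inferInstance, Empty.elim, fun i => i.elim, fun i => i.elim, fun i => i.elim,
      fun i => i.elim, by simpa using ((IsZero.iff_id_eq_zero Z).1 hz).symm⟩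
  by_cases hi : IsInd Z
  · exact ⟨Unit, inferInstance, fun _ => Z, fun _ => 𝟙 Z, fun _ => 𝟙 Z, fun _ => hi,
      fun _ => by simp, by simp⟩
  simp only [IsInd, not_and, not_forall] at hi
  obtain ⟨e, he, hne⟩ := hi hz
  rw [not_or] at hne
  have key : ∀ e : Z ⟶ Z, e ≫ e = e → e ≠ 𝟙 Z →
      ∃ (I : Type) (_ : Fintype I) (X : I → C) (ι : ∀ i, X i ⟶ Z)
        (π : ∀ i, Z ⟶ X i), (∀ i, IsInd (X i)) ∧ (∀ i, ι i ≫ π i = 𝟙 (X i)) ∧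
        ∑ i, π i ≫ ι i = e := by
    intro e he he1
    obtain ⟨Y, i, p, hip, hpi⟩ := IsIdempotentComplete.idempotents_split Z e he
    let L : (Y ⟶ Y) →ₗ[k] (Z ⟶ Z) :=
      { toFun := fun f => p ≫ f ≫ i
        map_add' := by simp
        map_smul' := by simp }
    have hL : Function.Injective L := by
      intro f g hfg
      have : i ≫ (p ≫ f ≫ i) ≫ p = i ≫ (p ≫ g ≫ i) ≫ p := by
        exact congrArg (fun x => i ≫ x ≫ p) hfg
      simpa [hip, reassoc_of% hip] using this
    have hlt : Module.finrank k (Y ⟶ Y) < Module.finrank k (Z ⟶ Z) := by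
      rw [← LinearMap.finrank_range_of_inj hL]
      refine Submodule.finrank_lt fun htop => he1 ?_
      obtain ⟨f, hf⟩ : (𝟙 Z) ∈ LinearMap.range L := htop ▸ Submodule.mem_top
      have hf : p ≫ f ≫ i = 𝟙 Z := hf
      calc e = e ≫ p ≫ f ≫ i := by rw [hf, Category.comp_id]
        _ = p ≫ f ≫ i := by rw [← hpi, Category.assoc, reassoc_of% hip]
        _ = 𝟙 Z := hf
    obtain ⟨I, hI, X, ι, π, h1, h2, h3⟩ := ih _ hlt Y rfl
    refine ⟨I, hI, X, fun j => ι j ≫ i, fun j => p ≫ π j, h1, fun j => ?_, ?_⟩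
    · simp [reassoc_of% hip, h2]
    · calc ∑ j, (p ≫ π j) ≫ ι j ≫ i = p ≫ (∑ j, π j ≫ ι j) ≫ i := by
            simp [Preadditive.sum_comp, Preadditive.comp_sum]
        _ = e := by rw [h3, Category.id_comp, hpi]
  obtain ⟨I, hI, X, ι, π, h1, h2, h3⟩ := key e he hne.2
  obtain ⟨I', hI', X', ι', π', h1', h2', h3'⟩ := key (𝟙 Z - e)
    (by simp [Preadditive.comp_sub, Preadditive.sub_comp, he])
    (fun h => hne.1 (by simpa using h))
  refine ⟨I ⊕ I', inferInstance, Sum.elim X X', fun x => Sum.casesOn x ι ι',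
    fun x => Sum.casesOn x π π', ?_, ?_, ?_⟩
  · rintro (i | i)
    · exact h1 i
    · exact h1' i
  · rintro (i | i)
    · exact h2 i
    · exact h2' i
  · rw [Fintype.sum_sum_type]
    change ∑ i, π i ≫ ι i + ∑ i, π' i ≫ ι' i = _
    rw [h3, h3']; abel

variable (C) in
/-- There are finitely many indecomposable objects up to isomorphism. -/
def FiniteType : Prop := ∃ (n : ℕ) (T : Fin n → C), ∀ X, IsInd X → ∃ i, Nonempty (X ≅ T i)

/-- Chains of `n` nonisomorphisms between indecomposables, with their composite. -/
inductive RadPath : ∀ X Y : C, (X ⟶ Y) → ℕ → Prop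
  | nil (X : C) : IsInd X → RadPath X X (𝟙 X) 0
  | cons {X Z Y : C} (f : X ⟶ Z) (g : Z ⟶ Y) (n : ℕ) : IsInd X → ¬ IsIso f → RadPath Z Y g n →
      RadPath X Y (f ≫ g) (n + 1)

lemma RadPath.isInd {X Y : C} {f : X ⟶ Y} {n : ℕ} (h : RadPath X Y f n) : IsInd X ∧ IsInd Y := by
  induction h with
  | nil X h => exact ⟨h, h⟩
  | cons f g n h _ _ ih => exact ⟨h, ih.2⟩

/-- Long chains of nonisomorphisms between indecomposables have zero composite. -/
lemma exists_radPath_bound [∀ X Y : C, FiniteDimensional k (X ⟶ Y)] (hT : FiniteType C) :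
    ∃ N : ℕ, ∀ (X Y : C) (f : X ⟶ Y), RadPath X Y f N → f = 0 := by
  obtain ⟨n, T, hT⟩ := hT
  have hS : ∀ X : C, ∃ (ι : X ⟶ ⨁ T) (π : (⨁ T) ⟶ X), IsInd X → ι ≫ π = 𝟙 X := by
    intro X
    by_cases hX : IsInd X
    · obtain ⟨i, ⟨e⟩⟩ := hT X hX
      exact ⟨e.hom ≫ biproduct.ι T i, biproduct.π T i ≫ e.inv, fun _ => by simp⟩
    · exact ⟨0, 0, fun h => absurd h hX⟩
  choose ι π hιπ using hS
  have hfin : FiniteDimensional k (End (⨁ T)) :=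
    inferInstanceAs (FiniteDimensional k ((⨁ T) ⟶ (⨁ T)))
  have := IsArtinianRing.of_finite k (End (⨁ T))
  obtain ⟨N, hN⟩ := IsArtinianRing.isNilpotent_jacobson_bot (R := End (⨁ T))
  have hrad : ∀ (X Y : C) (f : X ⟶ Y), IsInd X → IsInd Y → ¬ IsIso f →
      End.of (π X ≫ f ≫ ι Y) ∈ Ideal.jacobson (⊥ : Ideal (End (⨁ T))) := by
    intro X Y f hX hY hf
    rw [Ideal.mem_jacobson_iff]
    intro y
    let c : X ⟶ ⨁ T := f ≫ ι Y ≫ End.asHom y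
    have hh : ¬ IsIso (c ≫ π X) := by
      rintro ⟨v, hv, -⟩
      exact hf (hX.isIso_of_splitMono hY (r := ι Y ≫ End.asHom y ≫ π X ≫ v) (by simpa [c] using hv))
    have : FiniteDimensional k (End X) := inferInstanceAs (FiniteDimensional k (X ⟶ X))
    have hnil := (isUnit_or_isNilpotent k (B := End X) (fun e he => hX.2 e he)
      (End.of (c ≫ π X))).resolve_left (fun h => hh ((isUnit_iff_isIso _).1 h))
    have := (isUnit_iff_isIso _).1 hnil.isUnit_one_add
    obtain ⟨w, hw, -⟩ : IsIso (𝟙 X + c ≫ π X) := this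
    rw [Preadditive.add_comp, Category.id_comp, Category.assoc] at hw
    refine ⟨End.of (𝟙 _ - π X ≫ w ≫ c), ?_⟩
    rw [Submodule.mem_bot, sub_eq_zero]
    change (π X ≫ f ≫ ι Y) ≫ End.asHom y ≫ (𝟙 _ - π X ≫ w ≫ c) +
      (𝟙 (⨁ T) - π X ≫ w ≫ c) = 𝟙 (⨁ T)
    have e : (π X ≫ f ≫ ι Y) ≫ End.asHom y ≫ (𝟙 _ - π X ≫ w ≫ c) =
        π X ≫ c ≫ (𝟙 _ - π X ≫ w ≫ c) := by simp [c]
    have hwc : c = w ≫ c + c ≫ π X ≫ w ≫ c := by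
      simpa [Preadditive.add_comp] using (congrArg (fun x => x ≫ c) hw).symm
    rw [e]
    have e2 : c ≫ (𝟙 _ - π X ≫ w ≫ c) = w ≫ c := by
      rw [Preadditive.comp_sub, Category.comp_id, sub_eq_iff_eq_add]
      exact hwc
    rw [e2]; abel
  have hpath : ∀ (X Y : C) (f : X ⟶ Y) (m : ℕ), RadPath X Y f m →
      End.of (π X ≫ f ≫ ι Y) ∈ Ideal.jacobson (⊥ : Ideal (End (⨁ T))) ^ m := by
    intro X Y f m h
    induction h with
    | nil X h => rw [Submodule.pow_zero, Ideal.one_eq_top]; exact Submodule.mem_top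
    | @cons X Z Y f g m hX hf hg ih =>
      have e : End.of (π X ≫ (f ≫ g) ≫ ι Y) =
          End.of (π Z ≫ g ≫ ι Y) * End.of (π X ≫ f ≫ ι Z) := by
        simp [End.mul_def, reassoc_of% (hιπ Z hg.isInd.1)]
      rw [e, Submodule.pow_succ]
      exact Ideal.mul_mem_mul ih (hrad X Z f hX hg.isInd.1 hf)
  refine ⟨N, fun X Y f h => ?_⟩
  have h0 := hpath X Y f N h
  rw [hN] at h0
  have h1 : π X ≫ f ≫ ι Y = 0 := by simpa using h0
  have h2 : ι X ≫ (π X ≫ f ≫ ι Y) ≫ π Y = f := by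
    simp [reassoc_of% (hιπ X h.isInd.1), hιπ Y h.isInd.2]
  rw [← h2, h1]; simp

end Linear

section Refinement

open Relation

variable {C : Type*} [Category C] [Abelian C]

/-- A chain of nonisomorphisms with nonzero composite can be refined unless its ends are joined by
a path of irreducible morphisms. -/
lemma RadPath.refine (hdec : ∀ Z : C, ∃ (I : Type) (_ : Fintype I) (X : I → C) (ι : ∀ i, X i ⟶ Z)
      (π : ∀ i, Z ⟶ X i), (∀ i, IsInd (X i)) ∧ (∀ i, ι i ≫ π i = 𝟙 (X i)) ∧
      ∑ i, π i ≫ ι i = 𝟙 Z)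
    {X Y : C} {f : X ⟶ Y} {n : ℕ} (h : RadPath X Y f n) :
    ∀ (U : C) (a : U ⟶ X), a ≫ f ≠ 0 → (n = 0 ∧ X = Y) ∨ TransGen Arr X Y ∨
      ∃ f' : X ⟶ Y, RadPath X Y f' (n + 1) ∧ a ≫ f' ≠ 0 := by
  induction h with
  | nil X h => exact fun _ _ _ => Or.inl ⟨rfl, rfl⟩
  | @cons X Z Y f g n hX hf hg ih =>
    intro U a ha
    right
    have hZ := hg.isInd.1
    by_cases hirr : IsIrr f
    · rcases ih U (a ≫ f) (by simpa using ha) with ⟨-, rfl⟩ | h | ⟨f', hf', hne⟩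
      · exact Or.inl (.single ⟨hX, hZ, f, hirr⟩)
      · exact Or.inl (.head ⟨hX, hZ, f, hirr⟩ h)
      · exact Or.inr ⟨f ≫ f', .cons f f' _ hX hf hf', by simpa using hne⟩
    · right
      have h1 : ¬ ∃ r : Z ⟶ X, f ≫ r = 𝟙 X := fun ⟨r, hr⟩ => hf (hX.isIso_of_splitMono hZ hr)
      have h2 : ¬ ∃ s : Z ⟶ X, s ≫ f = 𝟙 Z := fun ⟨s, hs⟩ => hf (hX.isIso_of_splitEpi hZ hs)
      simp only [IsIrr, h1, h2, not_false_eq_true, true_and, not_forall, not_or] at hirr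
      obtain ⟨W, u, v, huv, hu, hv⟩ := hirr
      obtain ⟨I, hI, T, ι, π, k1, k2, k3⟩ := hdec W
      obtain ⟨i, hi⟩ : ∃ i, a ≫ (u ≫ π i) ≫ (ι i ≫ v) ≫ g ≠ 0 := by
        by_contra! hc
        apply ha
        calc a ≫ f ≫ g = a ≫ u ≫ (∑ i, π i ≫ ι i) ≫ v ≫ g := by
              rw [k3, Category.id_comp, reassoc_of% huv]
          _ = ∑ i, a ≫ (u ≫ π i) ≫ (ι i ≫ v) ≫ g := by
              simp only [Preadditive.sum_comp, Preadditive.comp_sum, Category.assoc]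
          _ = 0 := by simp only [hc, Finset.sum_const_zero]
      refine ⟨(u ≫ π i) ≫ (ι i ≫ v) ≫ g, .cons _ _ _ hX ?_ (.cons _ _ _ (k1 i) ?_ hg), hi⟩
      · rintro ⟨r, hr, -⟩
        exact hu ⟨π i ≫ r, by simpa using hr⟩
      · rintro ⟨r, -, hr⟩
        exact hv ⟨r ≫ ι i, by simpa using hr⟩

/-- In finite type, nonzero nonisomorphisms between indecomposables give rise to paths of
irreducible morphisms. -/
lemma Step.transGen_arr (k : Type*) [Field k] [Linear k C]
    [∀ X Y : C, FiniteDimensional k (X ⟶ Y)] (hT : FiniteType C) {X Y : C} (h : Step X Y) :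
    TransGen Arr X Y := by
  obtain ⟨hX, hY, f, hf0, hf⟩ := h
  by_contra hn
  have key : ∀ n : ℕ, ∃ g : X ⟶ Y, RadPath X Y g (n + 1) ∧ g ≠ 0 := by
    intro n
    induction n with
    | zero => exact ⟨f ≫ 𝟙 Y, .cons f (𝟙 Y) 0 hX hf (.nil Y hY), by simpa using hf0⟩
    | succ n ih =>
      obtain ⟨g, hg, hg0⟩ := ih
      rcases hg.refine (exists_decomp k) X (𝟙 X) (by simpa using hg0) with ⟨h, -⟩ | h | ⟨g', h, h0⟩
      · omega
      · exact absurd h hn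
      · exact ⟨g', h, by simpa using h0⟩
  have mono : ∀ (X Y : C) (f : X ⟶ Y) (n : ℕ), RadPath X Y f n → f ≠ 0 → ∀ m ≤ n,
      ∃ (Z : C) (g : Z ⟶ Y), RadPath Z Y g m ∧ g ≠ 0 := by
    intro X Y f n h
    induction h with
    | nil X hX =>
      intro h0 m hm
      obtain rfl : m = 0 := by omega
      exact ⟨X, 𝟙 X, .nil X hX, h0⟩
    | @cons X Z Y f g n hX hf hg ih =>
      intro h0 m hm
      rcases Nat.lt_or_ge n m with h | h
      · obtain rfl : m = n + 1 := by omega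
        exact ⟨X, f ≫ g, .cons f g n hX hf hg, h0⟩
      · exact ih (fun h => h0 (by rw [h, comp_zero])) m h
  obtain ⟨N, hN⟩ := exists_radPath_bound k hT
  obtain ⟨g, hg, hg0⟩ := key N
  obtain ⟨Z, g', hg', hg0'⟩ := mono X Y g _ hg hg0 N (by omega)
  exact hg0' (hN _ _ _ hg')

lemma transGen_step_of_iso {X X' Y : C} (e : X ≅ X') (h : TransGen Step X' Y) :
    TransGen Step X Y := by
  have aux : ∀ Z, Step X' Z → Step X Z := by
    rintro Z ⟨h1, h2, f, hf0, hf⟩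
    refine ⟨h1.of_iso e.symm, h2, e.hom ≫ f, fun h => hf0 ?_, fun h => hf ?_⟩
    · rw [← cancel_epi e.hom, h, comp_zero]
    · exact IsIso.of_isIso_comp_left e.hom f
  induction h with
  | single h => exact .single (aux _ h)
  | tail _ h ih => exact .tail ih h

lemma acyclic_of_no_cycle (k : Type*) [Field k] [Linear k C]
    [∀ X Y : C, FiniteDimensional k (X ⟶ Y)] (hT : FiniteType C)
    (hcyc : ∀ X : C, ¬ TransGen Arr X X) : Acyclic C := by
  have aux : ∀ X Y Z : C, ReflTransGen NZ X Y → Step Y Z → TransGen Step X Z := by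
    intro X Y Z h hs
    induction h using ReflTransGen.head_induction_on with
    | refl => exact .single hs
    | @head X X' h _ ih =>
      obtain ⟨h1, h2, f, hf⟩ := h
      by_cases hi : IsIso f
      · exact transGen_step_of_iso (asIso f) ih
      · exact .head ⟨h1, h2, f, hf, hi⟩ ih
  intro X Y h hs
  have : TransGen Step X X := aux X Y X h hs
  apply hcyc X
  clear h hs
  have aux2 : ∀ Y, TransGen Step X Y → TransGen Arr X Y := by
    intro Y h
    induction h with
    | single h => exact h.transGen_arr k hT
    | tail _ h ih => exact ih.trans (h.transGen_arr k hT)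
  exact aux2 X this

lemma Acyclic.brick (hac : Acyclic C) (X : C) (hX : IsInd X) (f : X ⟶ X) : f = 0 ∨ IsIso f := by
  by_contra! h
  exact hac X X .refl ⟨hX, hX, f, h.1, h.2⟩

lemma finiteBrick_of_acyclic (k : Type*) [Field k] [Linear k C]
    [∀ X Y : C, FiniteDimensional k (X ⟶ Y)] (hT : FiniteType C) (hac : Acyclic C)
    (hd : ∃ d : C → ℕ, (∀ (X Y : C) (f : X ⟶ Y), Mono f → d Y ≤ d X → IsIso f) ∧
      (∀ (X Y : C) (f : X ⟶ Y), Epi f → d X ≤ d Y → IsIso f)) : FiniteBrick C where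
  decomp := exists_decomp k
  brick := hac.brick
  finite := hT
  gens_left X Y := by
    refine ⟨_, Module.finBasis k (X ⟶ Y), fun f => ⟨fun i => (Module.finBasis k (X ⟶ Y)).repr f i •
      𝟙 X, ?_⟩⟩
    conv_lhs => rw [← (Module.finBasis k (X ⟶ Y)).sum_repr f]
    simp
  gens_right X Y := by
    refine ⟨_, Module.finBasis k (X ⟶ Y), fun f => ⟨fun i => (Module.finBasis k (X ⟶ Y)).repr f i •
      𝟙 Y, ?_⟩⟩
    conv_lhs => rw [← (Module.finBasis k (X ⟶ Y)).sum_repr f]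
    simp
  length := hd

lemma Acyclic.exists_scalar (k : Type*) [Field k] [Linear k C]
    [∀ X Y : C, FiniteDimensional k (X ⟶ Y)] [IsAlgClosed k] (hac : Acyclic C) {X : C}
    (hX : IsInd X) (f : X ⟶ X) : ∃ a : k, f = a • 𝟙 X := by
  have hne : 𝟙 X ≠ 0 := fun h => hX.1 ((IsZero.iff_id_eq_zero X).2 h)
  have h1 := finrank_endomorphism_eq_one k (X := X) fun f => by
    constructor
    · rintro ⟨g, hg, -⟩ rfl
      exact hne (by simpa using hg.symm)
    · exact fun h => (hac.brick X hX f).resolve_left h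
  obtain ⟨a, ha⟩ := (finrank_eq_one_iff_of_nonzero' (𝟙 X) hne).1 h1 f
  exact ⟨a, ha.symm⟩

end Refinement

section Radical

open Relation

variable {C : Type*} [Category C] [Abelian C]

/-- Morphisms out of an object onto which all epimorphisms split lift along epimorphisms. -/
lemma EpisSplit.exists_lift {Q Y Z : C} (hQ : EpisSplit Q) (p : Y ⟶ Z) [Epi p] (f : Q ⟶ Z) :
    ∃ l : Q ⟶ Y, l ≫ p = f := by
  obtain ⟨s, hs⟩ := hQ _ (pullback.fst f p) inferInstance
  exact ⟨s ≫ pullback.snd f p, by rw [Category.assoc, ← pullback.condition, reassoc_of% hs]⟩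

lemma FiniteBrick.exists_mono_isRightAlmostSplit (H : FiniteBrick C) {Q : C} (hQ : IsInd Q)
    (hQs : EpisSplit Q) : ∃ (J : C) (j : J ⟶ Q), Mono j ∧ IsRightAlmostSplit j := by
  obtain ⟨E, g, hg⟩ := H.exists_isRightAlmostSplit hQ
  refine ⟨image g, image.ι g, inferInstance, fun ⟨s, hs⟩ => ?_, fun X f hf => ?_⟩
  · obtain ⟨l, hl⟩ := hQs.exists_lift (factorThruImage g) s
    exact hg.1 ⟨l, by rw [← image.fac g, reassoc_of% hl, hs]⟩
  · obtain ⟨t, ht⟩ := hg.2 X f hf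
    exact ⟨t ≫ factorThruImage g, by simpa using ht⟩

lemma IsRightAlmostSplit.exists_splitMono {D : Type*} [Category D] {J Q W : D} {j : J ⟶ Q}
    (hj : IsRightAlmostSplit j) {f : W ⟶ Q} (hf : IsIrr f) :
    ∃ (t : W ⟶ J) (p : J ⟶ W), t ≫ p = 𝟙 W ∧ t ≫ j = f := by
  obtain ⟨t, ht⟩ := hj.2 W f hf.2.1
  rcases hf.2.2 J t j ht with ⟨r, hr⟩ | h
  · exact ⟨t, r, hr, ht⟩
  · exact absurd h hj.1

lemma IsRightAlmostSplit.isIrr_comp {J Q R : C} {j : J ⟶ Q} [Mono j] (hj : IsRightAlmostSplit j)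
    (hQ : IsInd Q) (hR : IsInd R) {i : R ⟶ J} {p : J ⟶ R} (hip : i ≫ p = 𝟙 R) :
    IsIrr (i ≫ j) := by
  have hnse : ¬ ∃ s : Q ⟶ R, s ≫ i ≫ j = 𝟙 Q := fun ⟨s, hs⟩ => hj.1 ⟨s ≫ i, by simpa using hs⟩
  refine ⟨fun ⟨r, hr⟩ => ?_, hnse, fun Z u v huv => ?_⟩
  · have := hR.isIso_of_splitMono hQ hr
    exact hnse ⟨inv (i ≫ j), IsIso.inv_hom_id _⟩
  · by_cases hv : ∃ s : Q ⟶ Z, s ≫ v = 𝟙 Q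
    · exact Or.inr hv
    · obtain ⟨t, ht⟩ := hj.2 Z v hv
      left
      refine ⟨t ≫ p, ?_⟩
      have : u ≫ t = i := by rw [← cancel_mono j, Category.assoc, ht, huv]
      rw [reassoc_of% this, hip]

/-- If `Q` has no nonzero morphism to `X`, then `X` has no nonzero morphism to the top of `Q`. -/
lemma IsRightAlmostSplit.eq_zero_of_cokernel {J Q X : C} {j : J ⟶ Q} [Mono j]
    (hj : IsRightAlmostSplit j) (hX : ∀ f : Q ⟶ X, f = 0) (f : X ⟶ cokernel j) : f = 0 := by
  by_cases h : ∃ s : Q ⟶ pullback f (cokernel.π j), s ≫ pullback.snd f (cokernel.π j) = 𝟙 Q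
  · exfalso
    obtain ⟨s, hs⟩ := h
    have h0 : cokernel.π j = 0 := by
      rw [← Category.id_comp (cokernel.π j), ← hs, Category.assoc, ← pullback.condition,
        ← Category.assoc, hX (s ≫ _), zero_comp]
    have : Epi j := Preadditive.epi_of_cokernel_zero h0
    have : IsIso j := isIso_of_mono_of_epi j
    exact hj.1 ⟨inv j, IsIso.inv_hom_id j⟩
  · obtain ⟨t, ht⟩ := hj.2 _ _ h
    rw [← cancel_epi (pullback.fst f (cokernel.π j)), pullback.condition, ← ht, Category.assoc,
      cokernel.condition, comp_zero, comp_zero]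

/-- The second leg of the pushout of a monomorphism is the kernel of the induced morphism to the
cokernel. -/
lemma exists_lift_pushout_inr {J Q X T : C} (j : J ⟶ Q) [Mono j] (g : J ⟶ X)
    (f : T ⟶ pushout j g)
    (hf : f ≫ pushout.desc (cokernel.π j) (0 : X ⟶ cokernel j) (by simp) = 0) :
    ∃ l : T ⟶ X, l ≫ pushout.inr j g = f := by
  let p : pushout j g ⟶ cokernel j := pushout.desc (cokernel.π j) 0 (by simp)
  have hp : pushout.inr j g ≫ p = 0 := pushout.inr_desc _ _ _
  have hpi : ∀ {T : C} (y : cokernel j ⟶ T), pushout.inl j g ≫ p ≫ y = cokernel.π j ≫ y :=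
    fun y => pushout.inl_desc_assoc _ _ _ y
  have hc : IsColimit (CokernelCofork.ofπ p hp) :=
    CokernelCofork.IsColimit.ofπ p hp
      (fun {T} y hy => cokernel.desc j (pushout.inl j g ≫ y) (by
        rw [pushout.condition_assoc, hy, comp_zero]))
      (fun {T} y hy => by
        apply pushout.hom_ext
        · rw [hpi, cokernel.π_desc]
        · rw [reassoc_of% hp, zero_comp, hy])
      (fun {T} y hy m hm => by
        rw [← cancel_epi (cokernel.π j), cokernel.π_desc, ← hm, hpi])
  have hk := Abelian.monoIsKernelOfCokernel _ hc
  exact ⟨hk.lift (KernelFork.ofι f hf), hk.fac _ WalkingParallelPair.zero⟩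

variable (k : Type*) [Field k] [Linear k C]

/-- Morphisms between extensions of the top of `Q` by `X` are diagonal. -/
lemma exists_smul_of_pushout_hom {J Q X : C} {j : J ⟶ Q} [Mono j] (hj : IsRightAlmostSplit j)
    (hQ : EpisSplit Q) (hQX : ∀ f : Q ⟶ X, f = 0) (hQQ : ∀ f : Q ⟶ Q, ∃ a : k, f = a • 𝟙 Q)
    (hXX : ∀ f : X ⟶ X, ∃ a : k, f = a • 𝟙 X) {g h : J ⟶ X} (Φ : pushout j g ⟶ pushout j h) :
    ∃ a b : k, pushout.inr j g ≫ Φ = a • pushout.inr j h ∧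
      pushout.inl j g ≫ Φ = b • pushout.inl j h ∧ a • g = b • h := by
  obtain ⟨x, hx⟩ := exists_lift_pushout_inr j h (pushout.inr j g ≫ Φ)
    (hj.eq_zero_of_cokernel hQX _)
  obtain ⟨a, rfl⟩ := hXX x
  obtain ⟨y, hy⟩ := hQ.exists_lift (cokernel.π j) ((pushout.inl j g ≫ Φ) ≫
    pushout.desc (cokernel.π j) (0 : X ⟶ cokernel j) (by simp))
  obtain ⟨b, rfl⟩ := hQQ y
  obtain ⟨z, hz⟩ := exists_lift_pushout_inr j h (pushout.inl j g ≫ Φ - b • pushout.inl j h) (by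
    rw [Preadditive.sub_comp, ← hy, Linear.smul_comp, Linear.smul_comp, pushout.inl_desc,
      Category.id_comp, sub_self])
  rw [hQX z, zero_comp, eq_comm, sub_eq_zero] at hz
  have hx' : pushout.inr j g ≫ Φ = a • pushout.inr j h := by rw [← hx]; simp
  refine ⟨a, b, hx', hz, ?_⟩
  rw [← cancel_mono (pushout.inr j h), Linear.smul_comp, Linear.smul_comp, ← pushout.condition,
    ← Linear.comp_smul, ← Linear.comp_smul, ← hz, ← hx', pushout.condition_assoc]

/-- In finite directed type, the restriction of `Hom(-, X)` to the radical of a projective `Q` not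
mapping to `X` is at most one-dimensional: otherwise the pushouts along a pencil of morphisms would
be infinitely many indecomposables. -/
lemma Acyclic.exists_linear_relation [∀ X Y : C, FiniteDimensional k (X ⟶ Y)] [IsAlgClosed k]
    (hac : Acyclic C) (hT : FiniteType C) {J Q X : C} {j : J ⟶ Q} [Mono j]
    (hj : IsRightAlmostSplit j) (hQi : IsInd Q) (hQ : EpisSplit Q) (hX : IsInd X)
    (hQX : ∀ f : Q ⟶ X, f = 0) (g₁ g₂ : J ⟶ X) :
    ∃ a b : k, (a ≠ 0 ∨ b ≠ 0) ∧ a • g₁ + b • g₂ = 0 := by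
  by_contra! hind
  replace hind : ∀ a b : k, a • g₁ + b • g₂ = 0 → a = 0 ∧ b = 0 := fun a b h => by
    by_contra hc
    exact hind a b (by tauto) h
  have hhom : ∀ (g h : J ⟶ X) (Φ : pushout j g ⟶ pushout j h),
      ∃ a b : k, pushout.inr j g ≫ Φ = a • pushout.inr j h ∧
      pushout.inl j g ≫ Φ = b • pushout.inl j h ∧ a • g = b • h := fun g h Φ =>
    exists_smul_of_pushout_hom k hj hQ hQX (fun f => hac.exists_scalar k hQi f)
      (fun f => hac.exists_scalar k hX f) Φ
  have hinr : ∀ g : J ⟶ X, pushout.inr j g ≠ 0 := fun g h0 => hX.1 <| by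
    rw [IsZero.iff_id_eq_zero, ← cancel_mono (pushout.inr j g), h0]; simp
  have hne : ∀ c : k, g₁ + c • g₂ ≠ 0 := fun c h => by
    simpa using (hind 1 c (by simpa using h)).1
  have hN : ∀ g : J ⟶ X, g ≠ 0 → IsInd (pushout j g) := by
    intro g hg
    refine ⟨fun hz => hinr g (hz.eq_zero_of_tgt _), fun e he => ?_⟩
    obtain ⟨a, b, h1, h2, h3⟩ := hhom g g e
    have hab : a = b := smul_left_injective k hg h3
    subst hab
    have hea : e = a • 𝟙 _ := by
      apply pushout.hom_ext
      · rw [h2]; simp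
      · rw [h1]; simp
    have h4 : (a * a) • pushout.inr j g = a • pushout.inr j g := by
      have := congrArg (fun x => pushout.inr j g ≫ x) he
      simpa [hea, smul_smul] using this
    have h5 : a * a = a := smul_left_injective k (hinr g) h4
    rcases (IsIdempotentElem.iff_eq_zero_or_one (p := a)).1 h5 with h | h <;> simp [hea, h]
  obtain ⟨n, T, hT⟩ := hT
  choose i hi using fun c : k => hT _ (hN _ (hne c))
  have : Infinite k := IsAlgClosed.instInfinite
  obtain ⟨c, d, hcd, h⟩ : ∃ c d, i c = i d ∧ c ≠ d := by
    simpa [Function.Injective] using not_injective_infinite_finite i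
  obtain ⟨e₁⟩ := hi c
  obtain ⟨e₂⟩ := hi d
  let e : pushout j (g₁ + c • g₂) ≅ pushout j (g₁ + d • g₂) :=
    e₁ ≪≫ eqToIso (by rw [hcd]) ≪≫ e₂.symm
  obtain ⟨a, b, h1, h2, h3⟩ := hhom _ _ e.hom
  obtain ⟨h4, h5⟩ := hind (a - b) (a * c - b * d) (by
    rw [← sub_eq_zero] at h3
    rw [← h3]; module)
  obtain rfl : a = b := sub_eq_zero.1 h4
  have ha : a = 0 := by
    rw [← mul_sub] at h5
    exact (mul_eq_zero.1 h5).resolve_right (sub_ne_zero.2 h)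
  apply hinr (g₁ + c • g₂)
  rw [← cancel_mono e.hom, h1, ha]; simp

/-- The finiteness property driving the descent: two indecomposable summands of the radical of a
projective are never joined by a path of irreducible morphisms. -/
lemma FiniteBrick.not_transGen_arr (H : FiniteBrick C) [∀ X Y : C, FiniteDimensional k (X ⟶ Y)]
    [IsAlgClosed k] (hac : Acyclic C) (hT : FiniteType C) {Q W X : C} (hQ : EpisSplit Q)
    (hWQ : Arr W Q) (hXQ : Arr X Q) : ¬ TransGen Arr W X := by
  intro hWX
  have hQX : ¬ ReflTransGen NZ Q X := fun h => hac Q X h hXQ.step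
  have hstep := hXQ.step
  obtain ⟨J, j, hjm, hj⟩ := H.exists_mono_isRightAlmostSplit hWQ.2.1 hQ
  obtain ⟨hW, hQi, f, hf⟩ := hWQ
  obtain ⟨hX, -, g, hg⟩ := hXQ
  obtain ⟨tW, pW, htW, rfl⟩ := hj.exists_splitMono hf
  obtain ⟨tX, pX, htX, -⟩ := hj.exists_splitMono hg
  have : Mono tW := mono_of_mono_fac htW
  obtain ⟨-, -, θ, hθ⟩ := H.nz_of_irr_mono hW hQi (tW ≫ j) hf hWX.to_reflTransGen hQX
  have hQX0 : ∀ f : Q ⟶ X, f = 0 := fun f => by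
    by_contra h
    exact hQX (.single ⟨hQi, hX, f, h⟩)
  obtain ⟨a, b, hab, h⟩ := hac.exists_linear_relation k hT hj hQi hQ hX hQX0 pX (pW ≫ θ)
  by_cases ha : a = 0
  · subst ha
    have hb : b ≠ 0 := by simpa using hab
    have := congrArg (fun x => tW ≫ x) h
    simp [reassoc_of% htW, hb, hθ] at this
  · have h1 := congrArg (fun x => tX ≫ x) h
    simp only [Preadditive.comp_add, Linear.comp_smul, htX, comp_zero] at h1
    have hs : (-(a⁻¹ * b) • (tX ≫ pW)) ≫ θ = 𝟙 X := by
      have h2 : b • (tX ≫ pW ≫ θ) = -(a • 𝟙 X) := eq_neg_of_add_eq_zero_right h1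
      rw [Linear.smul_comp, Category.assoc, neg_smul, mul_smul, h2, smul_neg, neg_neg, smul_smul,
        inv_mul_cancel₀ ha, one_smul]
    have hi : IsIso θ := hW.isIso_of_splitEpi hX hs
    obtain ⟨X', h3, h4⟩ := TransGen.tail'_iff.1 hWX
    refine hac X X' (.head ⟨hX, hW, inv θ, fun h0 => hX.1 ?_⟩ (reflTransGen_nz_of_arr h3)) h4.step
    rw [IsZero.iff_id_eq_zero, ← IsIso.inv_hom_id θ, h0, zero_comp]

lemma transGen_arr_of_reflTransGen_nz [∀ X Y : C, FiniteDimensional k (X ⟶ Y)]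
    (hT : FiniteType C) {X Y : C} (h : ReflTransGen NZ X Y) :
    Nonempty (Y ≅ X) ∨ TransGen Arr X Y := by
  have : Nonempty (Y ≅ X) ∨ TransGen Step X Y := by
    induction h using ReflTransGen.head_induction_on with
    | refl => exact Or.inl ⟨Iso.refl _⟩
    | @head X Z h _ ih =>
      obtain ⟨h1, h2, f, hf⟩ := h
      by_cases hi : IsIso f
      · rcases ih with ⟨⟨e⟩⟩ | ih
        · exact Or.inl ⟨e ≪≫ (asIso f).symm⟩
        · exact Or.inr (transGen_step_of_iso (asIso f) ih)
      · right
        have hs : Step X Z := ⟨h1, h2, f, hf, hi⟩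
        rcases ih with ⟨⟨e⟩⟩ | ih
        · refine .single ⟨h1, h2.of_iso e.symm, f ≫ e.inv, fun h => hf ?_, fun h => hi ?_⟩
          · rw [← cancel_mono e.inv, h, zero_comp]
          · exact IsIso.of_isIso_comp_right f e.inv
        · exact .head hs ih
  refine this.imp_right fun hs => ?_
  clear this h
  induction hs with
  | single h => exact h.transGen_arr k hT
  | tail _ h ih => exact ih.trans (h.transGen_arr k hT)

/-- In finite directed type, a summand of the radical of an indecomposable projective `P`, and the
target of an irreducible morphism from such a summand unless isomorphic to `P`, is not a successor
of `P`. -/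
theorem FiniteBrick.not_reflTransGen_nz (H : FiniteBrick C)
    [∀ X Y : C, FiniteDimensional k (X ⟶ Y)] [IsAlgClosed k] (hac : Acyclic C)
    (hT : FiniteType C) {P M J : C} (hP : IsInd P) (hPs : EpisSplit P) (hM : IsInd M)
    {j : J ⟶ P} [Mono j] (hj : IsRightAlmostSplit j)
    (h : (∃ (i : M ⟶ J) (p : J ⟶ M), i ≫ p = 𝟙 M) ∨ (¬ Nonempty (M ≅ P) ∧ ∃ (R : C)
      (i : R ⟶ J) (p : J ⟶ R) (f : R ⟶ M), i ≫ p = 𝟙 R ∧ IsIrr f)) :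
    ¬ ReflTransGen NZ P M := by
  intro hPM
  rcases h with ⟨i, p, hip⟩ | ⟨hMP, R, i, p, f, hip, hf⟩
  · exact hac P M hPM (Arr.step ⟨hM, hP, i ≫ j, hj.isIrr_comp hP hM hip⟩)
  · obtain ⟨R', i', p', hR', hip', hf'⟩ := H.exists_irr_summand hM hf
    have hRP : Arr R' P := ⟨hR', hP, (i' ≫ i) ≫ j, hj.isIrr_comp hP hR' (p := p ≫ p') (by
      rw [Category.assoc, reassoc_of% hip, hip'])⟩
    have hPM' := (transGen_arr_of_reflTransGen_nz k hT hPM).resolve_left hMP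
    exact H.descent hPs hRP (fun Q W X hQ hW hX => H.not_transGen_arr k hac hT hQ hW hX)
      hPM'.to_reflTransGen R' ⟨hR', hM, i' ≫ f, hf'⟩ .refl fun h => absurd ⟨eqToIso h⟩ hMP

end Radical

section Modules

open Relation ModuleCat

variable {A : Type} [Ring A]

lemma isIso_of_bijective_hom {X Y : FGModuleCat.{0} A} (f : X ⟶ Y)
    (hf : Function.Bijective f.hom.hom) : IsIso f :=
  (LinearEquiv.ofBijective f.hom.hom hf).toFGModuleCatIso.isIso_hom

lemma finIndec_iff (X : FGModuleCat.{0} A) : FinIndec A X.obj ↔ IsInd X := by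
  have hz : IsZero X ↔ ¬ Nontrivial X.obj := by
    rw [IsZero.iff_id_eq_zero, not_nontrivial_iff_subsingleton]
    constructor
    · intro h
      refine ⟨fun x y => ?_⟩
      have h1 : ∀ x : X.obj, x = 0 := fun x =>
        congrArg (fun f : X ⟶ X => f.hom.hom x) h
      rw [h1 x, h1 y]
    · intro h
      ext x
      exact Subsingleton.elim (α := X.obj) _ _
  constructor
  · rintro ⟨-, h1, h2⟩
    refine ⟨fun h => hz.1 h h1, fun e he => ?_⟩
    rcases h2 e.hom (congrArg (fun f : X ⟶ X => f.hom) he) with h | h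
    · exact Or.inl (ObjectProperty.hom_ext _ h)
    · exact Or.inr (ObjectProperty.hom_ext _ h)
  · rintro ⟨h1, h2⟩
    refine ⟨X.property, not_not.1 fun h => h1 (hz.2 h), fun e he => ?_⟩
    rcases h2 (ObjectProperty.homMk e) (ObjectProperty.hom_ext _ he) with h | h
    · exact Or.inl (congrArg (fun f : X ⟶ X => f.hom) h)
    · exact Or.inr (congrArg (fun f : X ⟶ X => f.hom) h)

lemma irredMor_iff {X Y : FGModuleCat.{0} A} (f : X ⟶ Y) : IrredMor A f.hom ↔ IsIrr f := by
  constructor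
  · rintro ⟨h1, h2, h3⟩
    refine ⟨fun ⟨g, hg⟩ => h1 ⟨g.hom, congrArg (fun f : X ⟶ X => f.hom) hg⟩,
      fun ⟨g, hg⟩ => h2 ⟨g.hom, congrArg (fun f : Y ⟶ Y => f.hom) hg⟩, fun Z u v h => ?_⟩
    rcases h3 Z.obj Z.property u.hom v.hom (congrArg (fun f : X ⟶ Y => f.hom) h.symm) with
      ⟨r, hr⟩ | ⟨s, hs⟩
    · exact Or.inl ⟨ObjectProperty.homMk r, ObjectProperty.hom_ext _ hr⟩
    · exact Or.inr ⟨ObjectProperty.homMk s, ObjectProperty.hom_ext _ hs⟩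
  · rintro ⟨h1, h2, h3⟩
    refine ⟨fun ⟨g, hg⟩ => h1 ⟨ObjectProperty.homMk g, ObjectProperty.hom_ext _ hg⟩,
      fun ⟨g, hg⟩ => h2 ⟨ObjectProperty.homMk g, ObjectProperty.hom_ext _ hg⟩, fun Z hZ u v h => ?_⟩
    rcases h3 ⟨Z, hZ⟩ (ObjectProperty.homMk u) (ObjectProperty.homMk v)
      (ObjectProperty.hom_ext _ h.symm) with ⟨r, hr⟩ | ⟨s, hs⟩
    · exact Or.inl ⟨r.hom, congrArg (fun f : X ⟶ X => f.hom) hr⟩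
    · exact Or.inr ⟨s.hom, congrArg (fun f : Y ⟶ Y => f.hom) hs⟩

lemma finite_of_finite (k : Type) [Field k] [Algebra k A] [FiniteDimensional k A]
    (X : FGModuleCat.{0} A) : Module.Finite k X.obj :=
  have : Module.Finite A X.obj := X.property
  Module.Finite.trans A X.obj

variable [IsNoetherianRing A]

lemma injective_hom_of_mono {X Y : FGModuleCat.{0} A} (f : X ⟶ Y) [Mono f] :
    Function.Injective f.hom.hom :=
  (ModuleCat.mono_iff_injective ((forget₂ (FGModuleCat A) (ModuleCat A)).map f)).1 inferInstance

lemma surjective_hom_of_epi {X Y : FGModuleCat.{0} A} (f : X ⟶ Y) [Epi f] :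
    Function.Surjective f.hom.hom :=
  (ModuleCat.epi_iff_surjective ((forget₂ (FGModuleCat A) (ModuleCat A)).map f)).1 inferInstance

lemma exists_irrPath_of_transGen {X Y : FGModuleCat.{0} A} (h : TransGen Arr X Y) :
    ∃ (f : X.obj ⟶ Y.obj) (n : ℕ), 1 ≤ n ∧ IrrPath A X.obj Y.obj f n := by
  induction h using TransGen.head_induction_on with
  | single h =>
    obtain ⟨hX, hY, f, hf⟩ := h
    exact ⟨_, 1, le_rfl, .cons f.hom (𝟙 _) 0 ((finIndec_iff _).2 hX) ((irredMor_iff f).2 hf)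
      (.nil _ ((finIndec_iff _).2 hY))⟩
  | head h _ ih =>
    obtain ⟨hX, hY, f, hf⟩ := h
    obtain ⟨g, n, -, hg⟩ := ih
    exact ⟨_, n + 1, by omega, .cons f.hom g n ((finIndec_iff _).2 hX) ((irredMor_iff f).2 hf) hg⟩

lemma reflTransGen_of_reach {M N : ModuleCat.{0} A} (h : Reach A M N) :
    ∀ (hM : Module.Finite A M) (hN : Module.Finite A N),
      ReflTransGen NZ (⟨M, hM⟩ : FGModuleCat A) ⟨N, hN⟩ := by
  induction h with
  | refl M h => exact fun _ _ => .refl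
  | @cons M X N hM hX hf _ ih =>
    obtain ⟨f, hf⟩ := hf
    intro h1 h2
    refine .head ⟨(finIndec_iff ⟨M, h1⟩).1 hM, (finIndec_iff ⟨X, hX.1⟩).1 hX,
      ObjectProperty.homMk f, fun h0 => hf ?_⟩ (ih hX.1 h2)
    exact congrArg (fun f : (⟨M, h1⟩ : FGModuleCat A) ⟶ ⟨X, hX.1⟩ => f.hom) h0

lemma episSplit_of_projective {P : FGModuleCat.{0} A} (hP : Module.Projective A P.obj) :
    EpisSplit P := by
  intro Z p hp
  obtain ⟨s, hs⟩ := Module.projective_lifting_property p.hom.hom LinearMap.id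
    (surjective_hom_of_epi p)
  exact ⟨FGModuleCat.ofHom s, FGModuleCat.hom_ext hs⟩

/-- The inclusion of the radical of an indecomposable projective. -/
noncomputable def radIncl (P : FGModuleCat.{0} A) : FGModuleCat.of A (radOf A P.obj) ⟶ P :=
  FGModuleCat.ofHom (radOf A P.obj).subtype

instance (P : FGModuleCat.{0} A) : Mono (radIncl P) := by
  refine ⟨fun f g h => FGModuleCat.hom_ext (LinearMap.ext fun x => ?_)⟩
  exact Subtype.ext (congrArg (fun φ : _ ⟶ P => φ.hom.hom x) h)

lemma isRightAlmostSplit_radIncl {P : FGModuleCat.{0} A} (hPi : IsInd P)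
    (hb : ∀ f : P ⟶ P, f = 0 ∨ IsIso f) (hP : Module.Projective A P.obj) :
    IsRightAlmostSplit (radIncl P) := by
  have hid : ∀ N : Submodule A P.obj, IsCoatom N → ∀ s : P.obj →ₗ[A] N,
      ¬ N.subtype ∘ₗ s = LinearMap.id := by
    intro N hN s hs
    refine hN.1 (eq_top_iff.2 fun x _ => ?_)
    have : (s x : P.obj) = x := LinearMap.congr_fun hs x
    exact this ▸ (s x).2
  constructor
  · rintro ⟨s, hs⟩
    have : Nontrivial P.obj := ((finIndec_iff P).2 hPi).2.1
    have : Module.Finite A P.obj := P.property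
    obtain ⟨N, hN⟩ := IsCoatomic.exists_coatom (Submodule A P.obj)
    refine hid N hN (Submodule.inclusion (sInf_le hN) ∘ₗ s.hom.hom) ?_
    exact LinearMap.ext fun x => congrArg (fun φ : P ⟶ P => φ.hom.hom x) hs
  · intro X f hf
    have hrange : LinearMap.range f.hom.hom ≤ radOf A P.obj := by
      refine le_sInf fun N hN => not_not.1 fun hle => hf ?_
      have htop : LinearMap.range f.hom.hom ⊔ N = ⊤ :=
        hN.2 _ (right_lt_sup.2 hle)
      obtain ⟨s, hs⟩ := Module.projective_lifting_property
        (LinearMap.coprod f.hom.hom N.subtype) LinearMap.id (by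
          rw [← LinearMap.range_eq_top, LinearMap.range_coprod, Submodule.range_subtype, htop])
      have hs' : ∀ x, f.hom.hom (s x).1 + ((s x).2 : P.obj) = x := fun x =>
        LinearMap.congr_fun hs x
      let s₁ : P ⟶ X := FGModuleCat.ofHom (LinearMap.fst A X.obj N ∘ₗ s)
      rcases hb (s₁ ≫ f) with h0 | hi
      · exfalso
        refine hid N hN (LinearMap.snd A X.obj N ∘ₗ s) (LinearMap.ext fun x => ?_)
        have h1 : f.hom.hom (s x).1 = 0 := congrArg (fun φ : P ⟶ P => φ.hom.hom x) h0
        simpa [h1] using hs' x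
      · exact ⟨inv (s₁ ≫ f) ≫ s₁, by rw [Category.assoc, IsIso.inv_hom_id]⟩
    exact ⟨FGModuleCat.ofHom (f.hom.hom.codRestrict _ fun x => hrange ⟨x, rfl⟩),
      FGModuleCat.hom_ext rfl⟩

lemma finiteType_of_repFinite (h : RepFinite A) : FiniteType (FGModuleCat.{0} A) := by
  obtain ⟨n, T, hT⟩ := h
  have hZ : ∀ i, ∃ Z : FGModuleCat.{0} A, Module.Finite A (T i) → Nonempty (Z.obj ≅ T i) := by
    intro i
    by_cases hi : Module.Finite A (T i)
    · exact ⟨⟨T i, hi⟩, fun _ => ⟨Iso.refl _⟩⟩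
    · exact ⟨0, fun h => absurd h hi⟩
  choose Z hZ using hZ
  refine ⟨n, Z, fun X hX => ?_⟩
  obtain ⟨i, ⟨e⟩⟩ := hT X.obj ((finIndec_iff X).2 hX)
  have : Module.Finite A X.obj := X.property
  obtain ⟨e'⟩ := hZ i (Module.Finite.equiv e.toLinearEquiv)
  exact ⟨i, ⟨(e ≪≫ e'.symm).toLinearEquiv.toFGModuleCatIso⟩⟩

instance (k : Type) [Field k] [Algebra k A] [FiniteDimensional k A]
    (X Y : FGModuleCat.{0} A) : Module.Finite k (X ⟶ Y) := by
  have := finite_of_finite k X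
  have := finite_of_finite k Y
  let L : (X ⟶ Y) →ₗ[k] (X.obj →ₗ[k] Y.obj) :=
    { toFun := fun f => f.hom.hom.restrictScalars k
      map_add' := fun f g => rfl
      map_smul' := fun c f => LinearMap.ext fun x => rfl }
  refine Module.Finite.of_injective L fun f g h => FGModuleCat.hom_ext (LinearMap.ext fun x => ?_)
  exact LinearMap.congr_fun h x

lemma exists_length (k : Type) [Field k] [Algebra k A] [FiniteDimensional k A] :
    ∃ d : FGModuleCat.{0} A → ℕ,
    (∀ (X Y : FGModuleCat.{0} A) (f : X ⟶ Y), Mono f → d Y ≤ d X → IsIso f) ∧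
      (∀ (X Y : FGModuleCat.{0} A) (f : X ⟶ Y), Epi f → d X ≤ d Y → IsIso f) := by
  refine ⟨fun X => Module.finrank k X.obj, fun X Y f hf h => ?_, fun X Y f hf h => ?_⟩
  · have := finite_of_finite k X
    have := finite_of_finite k Y
    have hi := injective_hom_of_mono f
    have h' := h.antisymm' (LinearMap.finrank_le_finrank_of_injective
      (f := f.hom.hom.restrictScalars k) hi)
    exact isIso_of_bijective_hom f ⟨hi,
      (LinearMap.injective_iff_surjective_of_finrank_eq_finrank
        (f := f.hom.hom.restrictScalars k) h').1 hi⟩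
  · have := finite_of_finite k X
    have := finite_of_finite k Y
    have hs := surjective_hom_of_epi f
    have h' := h.antisymm (LinearMap.finrank_le_finrank_of_surjective
      (f := f.hom.hom.restrictScalars k) hs)
    exact isIso_of_bijective_hom f
      ⟨(LinearMap.injective_iff_surjective_of_finrank_eq_finrank
        (f := f.hom.hom.restrictScalars k) h').2 hs, hs⟩

end Modules

end CategoryTheory.Directed

/-- Lemma: if `A` is representation-finite with directed Auslander-Reiten quiver,
`P` is an indecomposable projective and `M` is an indecomposable module which either is a
direct summand of `rad P`, or receives an irreducible morphism from a direct summand of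
`rad P` with `M ≇ P`, then `M` is not a successor of `P`. -/
theorem not_successor_of_radical_summand (k A : Type) [Field k] [IsAlgClosed k]
    [Ring A] [Algebra k A] [FiniteDimensional k A]
    (hrf : RepFinite A)
    (hdir : ¬ ∃ (M N : ModuleCat.{0} A) (f : M ⟶ N) (n : ℕ),
      1 ≤ n ∧ IrrPath A M N f n ∧ Nonempty (M ≅ N))
    (P M : ModuleCat.{0} A) (hP : FinIndec A P) (hPproj : Module.Projective A P)
    (hM : FinIndec A M)
    (hhyp : IsSummand A M (ModuleCat.of A (radOf A P)) ∨
      ((¬ Nonempty (M ≅ P)) ∧ ∃ R : ModuleCat.{0} A,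
        IsSummand A R (ModuleCat.of A (radOf A P)) ∧ ∃ f : R ⟶ M, IrredMor A f)) :
    ¬ Reach A P M := by
  have : IsNoetherianRing A := IsNoetherianRing.of_finite k A
  have hT := CategoryTheory.Directed.finiteType_of_repFinite hrf
  have hac := CategoryTheory.Directed.acyclic_of_no_cycle k hT fun X hX => by
    obtain ⟨f, n, hn, hf⟩ := CategoryTheory.Directed.exists_irrPath_of_transGen hX
    exact hdir ⟨_, _, f, n, hn, hf, ⟨Iso.refl _⟩⟩
  have H := CategoryTheory.Directed.finiteBrick_of_acyclic k hT hac
    (CategoryTheory.Directed.exists_length k)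
  let P' : FGModuleCat A := ⟨P, hP.1⟩
  let M' : FGModuleCat A := ⟨M, hM.1⟩
  have hP' : CategoryTheory.Directed.IsInd P' := (CategoryTheory.Directed.finIndec_iff P').1 hP
  have hM' : CategoryTheory.Directed.IsInd M' := (CategoryTheory.Directed.finIndec_iff M').1 hM
  have hj := CategoryTheory.Directed.isRightAlmostSplit_radIncl hP' (hac.brick P' hP') hPproj
  intro hreach
  refine H.not_reflTransGen_nz k hac hT hP' (CategoryTheory.Directed.episSplit_of_projective hPproj)
    hM' hj ?_ (CategoryTheory.Directed.reflTransGen_of_reach hreach hP.1 hM.1)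
  rcases hhyp with ⟨i, p, hip⟩ | ⟨hMP, R, ⟨i, p, hip⟩, f, hf⟩
  · exact Or.inl ⟨ObjectProperty.homMk i, ObjectProperty.homMk p, ObjectProperty.hom_ext _ hip⟩
  · have hJ : Module.Finite A (ModuleCat.of A (radOf A P)) :=
      have := hP.1
      inferInstanceAs (Module.Finite A (radOf A P))
    have hR : Module.Finite A R :=
      Module.Finite.of_surjective p.hom fun x =>
        ⟨i.hom x, congrArg (fun φ : R ⟶ R => φ.hom x) hip⟩
    let R' : FGModuleCat A := ⟨R, hR⟩
    let f' : R' ⟶ M' := ObjectProperty.homMk f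
    refine Or.inr ⟨fun ⟨e⟩ => hMP ⟨(ModuleCat.isFG A).ι.mapIso e⟩, R',
      ObjectProperty.homMk i, ObjectProperty.homMk p, f', ObjectProperty.hom_ext _ hip, ?_⟩
    exact (CategoryTheory.Directed.irredMor_iff f').1 hf
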